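/- arXiv:2202.13301 — 7 statements merged into one kernel-verified Lean document; each statement's English description precedes it below -/
import Mathlib

section
/- Let ω : ℚ_pˣ → ℂˣ be a ramified continuous character with conductor exponent c = c(ω) ≥ 2, let j be an integer with 0 < j < c, and let a ∈ ℚ_pˣ. Then the integral ∫_{U_j} ω(u) ψ(au) du (with respect to the additive Haar measure du giving ℤ_p volume 1) vanishes whenever v(a) ≠ −c; and when v(a) = −c it equals q^{−c} · Σ_b ω(b) ψ(ab), where b runs over any set of representatives of the finite quotient group U_j / U_c (each summand ω(b)ψ(ab) depends only on the coset b·U_c because v(a) = −c). -/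
open MeasureTheory

section PadicHaar

variable {p : ℕ} [Fact p.Prime]

lemma Padic.norm_eq_one_of_norm_sub_one_lt {x : ℚ_[p]} (h : ‖x - 1‖ < 1) : ‖x‖ = 1 := by
  have := Padic.add_eq_max_of_ne (p := p) (q := x - 1) (r := 1) (by rw [norm_one]; exact h.ne)
  rwa [sub_add_cancel, norm_one, max_eq_right h.le] at this

lemma Padic.norm_sub_le_max (x y : ℚ_[p]) : ‖x - y‖ ≤ max ‖x‖ ‖y‖ := by
  simpa [sub_eq_add_neg] using Padic.nonarchimedean x (-y)

lemma Padic.setOf_norm_le_one_eq_biUnion (n : ℕ) :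
    {x : ℚ_[p] | ‖x‖ ≤ 1} =
      ⋃ i ∈ Finset.range (p ^ n), Metric.closedBall (i : ℚ_[p]) ((p : ℝ) ^ (-(n : ℤ))) := by
  ext x
  simp only [Set.mem_ofPred_eq, Set.mem_iUnion, Finset.mem_range, Metric.mem_closedBall,
    dist_eq_norm, exists_prop]
  constructor
  · intro hx
    refine ⟨PadicInt.appr ⟨x, hx⟩ n, PadicInt.appr_lt _ _, ?_⟩
    have := (PadicInt.norm_le_pow_iff_mem_span_pow _ n).2
      (PadicInt.appr_spec n (⟨x, hx⟩ : ℤ_[p]))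
    rw [PadicInt.norm_def] at this
    exact_mod_cast this
  · rintro ⟨i, -, hi⟩
    have h1 : (p : ℝ) ^ (-(n : ℤ)) ≤ 1 :=
      zpow_le_one_of_nonpos₀ (mod_cast (Fact.out : p.Prime).one_le) (by simp)
    have := Padic.nonarchimedean (x - (i : ℚ_[p])) (i : ℚ_[p])
    rw [sub_add_cancel] at this
    exact this.trans (max_le (hi.trans h1) (by simpa using Padic.norm_int_le_one (p := p) (i : ℤ)))

lemma Padic.pairwiseDisjoint_closedBall_natCast (n : ℕ) :
    Set.PairwiseDisjoint (Finset.range (p ^ n) : Set ℕ)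
      fun i => Metric.closedBall (i : ℚ_[p]) ((p : ℝ) ^ (-(n : ℤ))) := by
  intro i hi k hk hik
  refine Set.disjoint_left.2 fun x hxi hxk => hik ?_
  simp only [Metric.mem_closedBall, dist_eq_norm] at hxi hxk
  have h := (Padic.norm_sub_le_max (x - (k : ℚ_[p])) (x - (i : ℚ_[p]))).trans (max_le hxk hxi)
  rw [show x - (k : ℚ_[p]) - (x - (i : ℚ_[p])) = (((i : ℤ) - (k : ℤ) : ℤ) : ℚ_[p]) by push_cast; ring,
    Padic.norm_int_le_pow_iff_dvd] at h
  have hmod : k ≡ i [MOD p ^ n] := (Nat.modEq_iff_dvd).2 (by exact_mod_cast h)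
  exact (Nat.ModEq.eq_of_lt_of_lt hmod (by simpa using hk) (by simpa using hi)).symm

variable [MeasurableSpace ℚ_[p]] [BorelSpace ℚ_[p]] (μ : Measure ℚ_[p]) [μ.IsAddHaarMeasure]

lemma Padic.measureReal_closedBall (hμ : μ {x : ℚ_[p] | ‖x‖ ≤ 1} = 1) (x : ℚ_[p]) (n : ℕ) :
    μ.real (Metric.closedBall x ((p : ℝ) ^ (-(n : ℤ)))) = (p : ℝ) ^ (-(n : ℤ)) := by
  have htrans (y : ℚ_[p]) : μ.real (Metric.closedBall y ((p : ℝ) ^ (-(n : ℤ)))) =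
      μ.real (Metric.closedBall x ((p : ℝ) ^ (-(n : ℤ)))) := by
    simp only [Measure.real]
    rw [← measure_preimage_add μ (y - x) (Metric.closedBall y _)]
    simp
  have h : μ.real {x : ℚ_[p] | ‖x‖ ≤ 1} = 1 := by simp [Measure.real, hμ]
  rw [Padic.setOf_norm_le_one_eq_biUnion n, measureReal_biUnion_finset
    (Padic.pairwiseDisjoint_closedBall_natCast n)
    (fun i _ => Metric.isClosed_closedBall.measurableSet)
    (fun i _ => (isCompact_closedBall _ _).measure_lt_top.ne)] at h
  simp only [htrans, Finset.sum_const, Finset.card_range, nsmul_eq_mul, Nat.cast_pow] at h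
  refine (eq_inv_of_mul_eq_one_right h).trans ?_
  rw [zpow_neg, zpow_natCast]

lemma Padic.measurePreserving_mul_left (hμ : μ {x : ℚ_[p] | ‖x‖ ≤ 1} = 1) {t : ℚ_[p]}
    (ht : ‖t‖ = 1) : MeasurePreserving (t * ·) μ μ := by
  have ht0 : t ≠ 0 := norm_ne_zero_iff.1 (by simp [ht])
  have hmeas : Measurable (t * · : ℚ_[p] → ℚ_[p]) := (continuous_const_mul t).measurable
  refine ⟨hmeas, ?_⟩
  have : (μ.map (t * ·)).IsAddHaarMeasure :=
    Measure.isAddHaarMeasure_map μ (AddMonoidHom.mulLeft t) (continuous_const_mul t)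
      (mul_left_surjective₀ ht0) (Homeomorph.mulLeft₀ t ht0).isClosedEmbedding.tendsto_cocompact
  have h := Measure.isAddLeftInvariant_eq_smul (μ.map (t * ·)) μ
  have hball := congrArg (fun ν : Measure ℚ_[p] => ν {x : ℚ_[p] | ‖x‖ ≤ 1}) h
  have hpre : (t * ·) ⁻¹' {x : ℚ_[p] | ‖x‖ ≤ 1} = {x : ℚ_[p] | ‖x‖ ≤ 1} := by
    ext x; simp [ht]
  simp only [Measure.smul_apply] at hball
  rw [Measure.map_apply hmeas (isClosed_le continuous_norm continuous_const).measurableSet,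
    hpre, hμ] at hball
  have hone : Measure.addHaarScalarFactor (μ.map (t * ·)) μ = 1 := by
    simpa [ENNReal.smul_def, eq_comm] using hball
  rwa [hone, one_smul] at h

end PadicHaar

/-- Let `ω` be a ramified continuous character of `ℚ_pˣ`
(valued in `ℂˣ`) with conductor exponent `c ≥ 2`, i.e. `ω` is trivial on
`U_c = 1 + p^c ℤ_p` but not on `U_{c-1}`.  Let `0 < j < c`, `a ∈ ℚ_pˣ` and let
`B` be any set of representatives of the finite quotient `U_j / U_c`.  Then the
integral `∫_{U_j} ω(u) ψ(au) du` (additive Haar measure with `μ(ℤ_p) = 1`)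
vanishes when `v(a) ≠ −c`, and equals `q^{−c} · Σ_{b ∈ B} ω(b) ψ(ab)` when
`v(a) = −c`. -/
theorem integral_char_mul_addChar_over_Uj
    {p : ℕ} [Fact p.Prime] [MeasurableSpace ℚ_[p]] [BorelSpace ℚ_[p]]
    (μ : Measure ℚ_[p]) [μ.IsAddHaarMeasure]
    (hμ : μ {x : ℚ_[p] | ‖x‖ ≤ 1} = 1)
    -- ψ : an unramified continuous additive character
    (ψ : ℚ_[p] → ℂ)
    (hψadd : ∀ x y : ℚ_[p], ψ (x + y) = ψ x * ψ y)
    (hψcont : Continuous ψ)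
    (hψtriv : ∀ x : ℚ_[p], ‖x‖ ≤ 1 → ψ x = 1)
    (hψntriv : ∃ x : ℚ_[p], ‖x‖ ≤ p ∧ ψ x ≠ 1)
    -- ω : a continuous multiplicative character of ℚ_pˣ valued in ℂˣ
    (ω : ℚ_[p] → ℂ)
    (hωmul : ∀ x y : ℚ_[p], x ≠ 0 → y ≠ 0 → ω (x * y) = ω x * ω y)
    (hωcont : ContinuousOn ω {x : ℚ_[p] | x ≠ 0})
    (hωne : ∀ x : ℚ_[p], x ≠ 0 → ω x ≠ 0)
    -- c = c(ω) ≥ 2 : ω trivial on U_c but not on U_{c-1}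
    (c : ℕ) (hc : 2 ≤ c)
    (hωc : ∀ u : ℚ_[p], ‖u - 1‖ ≤ (p : ℝ) ^ (-(c : ℤ)) → ω u = 1)
    (hωc' : ¬ ∀ u : ℚ_[p], ‖u - 1‖ ≤ (p : ℝ) ^ (-((c : ℤ) - 1)) → ω u = 1)
    (j : ℕ) (hj0 : 0 < j) (hjc : j < c)
    (a : ℚ_[p]) (ha : a ≠ 0)
    -- B : a set of representatives of U_j / U_c
    (B : Finset ℚ_[p])
    (hB : ∀ b ∈ B, ‖b - 1‖ ≤ (p : ℝ) ^ (-(j : ℤ)))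
    (hBrep : ∀ u : ℚ_[p], ‖u - 1‖ ≤ (p : ℝ) ^ (-(j : ℤ)) →
      ∃! b, b ∈ B ∧ ‖u / b - 1‖ ≤ (p : ℝ) ^ (-(c : ℤ))) :
    (a.valuation ≠ -(c : ℤ) →
      ∫ u in {u : ℚ_[p] | ‖u - 1‖ ≤ (p : ℝ) ^ (-(j : ℤ))}, ω u * ψ (a * u) ∂μ = 0) ∧
    (a.valuation = -(c : ℤ) →
      ∫ u in {u : ℚ_[p] | ‖u - 1‖ ≤ (p : ℝ) ^ (-(j : ℤ))}, ω u * ψ (a * u) ∂μ =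
        (p : ℂ) ^ (-(c : ℤ)) * ∑ b ∈ B, ω b * ψ (a * b)) := by
  have hp1 : (1 : ℝ) < p := mod_cast (Fact.out : p.Prime).one_lt
  have hp0 : (0 : ℝ) < p := zero_lt_one.trans hp1
  have hlt_one {n : ℤ} (hn : 0 < n) : (p : ℝ) ^ (-n) < 1 :=
    zpow_lt_one_of_neg₀ hp1 (by lia)
  have hanti {m n : ℤ} (h : m ≤ n) : (p : ℝ) ^ (-n) ≤ (p : ℝ) ^ (-m) :=
    zpow_le_zpow_right₀ hp1.le (by lia)
  have hnorm {u : ℚ_[p]} (hu : ‖u - 1‖ ≤ (p : ℝ) ^ (-(j : ℤ))) : ‖u‖ = 1 :=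
    Padic.norm_eq_one_of_norm_sub_one_lt (hu.trans_lt (hlt_one (by lia)))
  have hne {u : ℚ_[p]} (hu : ‖u‖ = 1) : u ≠ 0 := norm_ne_zero_iff.1 (by simp [hu])
  have hdiv {u b : ℚ_[p]} (hb : ‖b‖ = 1) : ‖u / b - 1‖ = ‖u - b‖ := by
    rw [div_sub_one (hne hb), norm_div, hb, div_one]
  have hω {u b : ℚ_[p]} (hb : ‖b‖ = 1) (h : ‖u - b‖ ≤ (p : ℝ) ^ (-(c : ℤ))) : ω u = ω b := by
    have h1 : ‖u / b - 1‖ ≤ (p : ℝ) ^ (-(c : ℤ)) := by rwa [hdiv hb]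
    have hub : ‖u / b‖ = 1 :=
      Padic.norm_eq_one_of_norm_sub_one_lt (h1.trans_lt (hlt_one (by lia)))
    rw [← div_mul_cancel₀ u (hne hb), hωmul _ _ (hne hub) (hne hb), hωc _ h1, one_mul]
  have hψ {x y : ℚ_[p]} (h : ‖x - y‖ ≤ 1) : ψ x = ψ y := by
    rw [← sub_add_cancel x y, hψadd, hψtriv _ h, one_mul]
  have hnorm_a := Padic.norm_eq_zpow_neg_valuation ha
  set U : Set ℚ_[p] := {u : ℚ_[p] | ‖u - 1‖ ≤ (p : ℝ) ^ (-(j : ℤ))} with hU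
  have hUadd {u s : ℚ_[p]} (hs : ‖s‖ ≤ (p : ℝ) ^ (-(j : ℤ))) : u + s ∈ U ↔ u ∈ U := by
    simp only [hU, Set.mem_ofPred_eq]
    constructor <;> intro hu
    · rw [show u - 1 = (u + s - 1) - s by ring]
      exact (Padic.norm_sub_le_max _ _).trans (max_le hu hs)
    · rw [show u + s - 1 = (u - 1) + s by ring]
      exact (Padic.nonarchimedean _ _).trans (max_le hu hs)
  have hUmeas : MeasurableSet U :=
    (isClosed_le (continuous_id.sub continuous_const).norm continuous_const).measurableSet
  have hzero {z : ℂ} (hz : z ≠ 1) {w : ℂ} (h : w = z * w) : w = 0 := by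
    have : (z - 1) * w = 0 := by rw [sub_mul, ← h]; ring
    exact (mul_eq_zero.1 this).resolve_left (sub_ne_zero.2 hz)
  refine ⟨fun hv => ?_, fun hv => ?_⟩
  · rcases lt_or_gt_of_ne hv with hv | hv
    · obtain ⟨x, hx, hψx⟩ := hψntriv
      have hs : ‖x / a‖ ≤ (p : ℝ) ^ (-(c : ℤ)) := by
        rw [norm_div, hnorm_a, div_le_iff₀ (zpow_pos hp0 _), ← zpow_add₀ hp0.ne']
        refine hx.trans ?_
        simpa using zpow_le_zpow_right₀ hp1.le (show (1 : ℤ) ≤ -c + -a.valuation by lia)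
      have hpre : (· + x / a) ⁻¹' U = U := by
        ext u; exact hUadd (hs.trans (hanti (by lia)))
      have h := (measurePreserving_add_right μ (x / a)).setIntegral_preimage_emb
        (Homeomorph.addRight (x / a)).measurableEmbedding (fun u => ω u * ψ (a * u)) U
      rw [hpre] at h
      refine hzero hψx ?_
      rw [← integral_const_mul, ← h]
      refine setIntegral_congr_fun hUmeas fun u hu => ?_
      rw [hω (hnorm hu) (show ‖u + x / a - u‖ ≤ _ by simpa using hs), mul_add,
        mul_div_cancel₀ _ ha, hψadd]
      ring
    · push Not at hωc'
      obtain ⟨t, ht, hωt⟩ := hωc'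
      have ht' : ‖t - 1‖ ≤ (p : ℝ) ^ (-(j : ℤ)) := ht.trans (hanti (by lia))
      have htn := hnorm ht'
      have hpre : (t * ·) ⁻¹' U = U := by
        ext u
        have h1 : t * u - 1 = t * (u - 1 + (t - 1) / t) := by field_simp [hne htn]; ring
        have h2 : t * u ∈ U ↔ u + (t - 1) / t ∈ U := by
          simp only [hU, Set.mem_ofPred_eq]
          rw [h1, norm_mul, htn, one_mul, sub_add_eq_add_sub]
        exact h2.trans (hUadd (by rwa [norm_div, htn, div_one]))
      have h := (Padic.measurePreserving_mul_left μ hμ htn).setIntegral_preimage_emb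
        (Homeomorph.mulLeft₀ t (hne htn)).measurableEmbedding (fun u => ω u * ψ (a * u)) U
      rw [hpre] at h
      refine hzero hωt ?_
      rw [← integral_const_mul, ← h]
      refine setIntegral_congr_fun hUmeas fun u hu => ?_
      have hun := hnorm hu
      have hau : ‖a * (t * u) - a * u‖ ≤ 1 := by
        rw [show a * (t * u) - a * u = a * (t - 1) * u by ring, norm_mul, norm_mul, hun, mul_one,
          hnorm_a]
        refine (mul_le_mul_of_nonneg_left ht (zpow_nonneg hp0.le _)).trans ?_
        rw [← zpow_add₀ hp0.ne']
        exact zpow_le_one_of_nonpos₀ hp1.le (by lia)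
      rw [hψ hau, hωmul _ _ (hne htn) (hne hun), mul_assoc]
  · have hUB : U = ⋃ b ∈ B, Metric.closedBall b ((p : ℝ) ^ (-(c : ℤ))) := by
      ext u
      simp only [Set.mem_iUnion, Metric.mem_closedBall, dist_eq_norm, exists_prop]
      constructor
      · intro hu
        obtain ⟨b, ⟨hb, hub⟩, -⟩ := hBrep u hu
        exact ⟨b, hb, by rwa [hdiv (hnorm (hB b hb))] at hub⟩
      · rintro ⟨b, hb, hub⟩
        rw [← add_sub_cancel b u]
        exact (hUadd (hub.trans (hanti (by lia)))).2 (hB b hb)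
    have hdisj : Set.PairwiseDisjoint (B : Set ℚ_[p])
        fun b => Metric.closedBall b ((p : ℝ) ^ (-(c : ℤ))) := by
      intro b hb b' hb' hbb'
      refine Set.disjoint_left.2 fun u hub hub' => hbb' ?_
      have hu : u ∈ U := hUB ▸ Set.mem_biUnion hb hub
      simp only [Metric.mem_closedBall, dist_eq_norm] at hub hub'
      rw [← hdiv (hnorm (hB _ hb))] at hub
      rw [← hdiv (hnorm (hB _ hb'))] at hub'
      exact (hBrep u hu).unique ⟨hb, hub⟩ ⟨hb', hub'⟩
    have hconst (b : ℚ_[p]) (hb : b ∈ B) :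
        Set.EqOn (fun u => ω u * ψ (a * u)) (fun _ => ω b * ψ (a * b))
          (Metric.closedBall b ((p : ℝ) ^ (-(c : ℤ)))) := by
      intro u hu
      rw [Metric.mem_closedBall, dist_eq_norm] at hu
      have hau : ‖a * u - a * b‖ ≤ 1 := by
        rw [← mul_sub, norm_mul, hnorm_a]
        refine (mul_le_mul_of_nonneg_left hu (zpow_nonneg hp0.le _)).trans ?_
        rw [← zpow_add₀ hp0.ne']
        exact zpow_le_one_of_nonpos₀ hp1.le (by lia)
      beta_reduce
      rw [hω (hnorm (hB b hb)) hu, hψ hau]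
    have hballmeas (b : ℚ_[p]) :
        MeasurableSet (Metric.closedBall b ((p : ℝ) ^ (-(c : ℤ)))) :=
      Metric.isClosed_closedBall.measurableSet
    rw [hUB, integral_biUnion_finset B (fun b _ => hballmeas b) hdisj, Finset.mul_sum]
    · refine Finset.sum_congr rfl fun b hb => ?_
      rw [setIntegral_congr_fun (hballmeas b) (hconst b hb), setIntegral_const,
        Padic.measureReal_closedBall μ hμ, Complex.real_smul]
      push_cast
      rfl
    · intro b hb
      refine IntegrableOn.congr_fun ?_ (hconst b hb).symm (hballmeas b)
      exact integrableOn_const (isCompact_closedBall _ _).measure_lt_top.ne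
end

section
/- Let ω : ℚ_pˣ → ℂˣ be a ramified continuous character with conductor exponent m = c(ω) ≥ 2, let j be an integer with 0 < j < m, and let y ∈ ℚ_pˣ. Then ∫_{ℤ_p} ω(1 + x p^j) ψ(−xy) dx = 0 unless v(y) = j − m; and when v(y) = j − m this integral equals q^{j−m} · ψ(y p^{−j}) · Σ_b ω(b) ψ(−b y p^{−j}), where b runs over any set of representatives of the quotient group U_j / U_m. -/
open MeasureTheory

section PadicBalls

variable {p : ℕ} [Fact p.Prime]

lemma Padic.norm_eq_one_of_norm_sub_one_lt_s1 {u : ℚ_[p]} (hu : ‖u - 1‖ < 1) : ‖u‖ = 1 := by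
  have h := Padic.add_eq_max_of_ne (p := p) (q := u - 1) (r := 1) (by simpa using hu.ne)
  rwa [sub_add_cancel, norm_one, max_eq_right hu.le] at h

lemma Padic.norm_sub_one_lt_of_le_zpow {u : ℚ_[p]} {n : ℕ} (hn : 0 < n)
    (hu : ‖u - 1‖ ≤ (p : ℝ) ^ (-(n : ℤ))) : ‖u - 1‖ < 1 :=
  hu.trans_lt (zpow_lt_one_of_neg₀ (mod_cast (Fact.out : p.Prime).one_lt) (by omega))

/-- The closed unit ball of `ℚ_[p]` is the union of `p ^ n` translates of the ball of radius
`p ^ (-n)`. -/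
lemma Padic.unitBall_eq_biUnion (n : ℕ) :
    {x : ℚ_[p] | ‖x‖ ≤ 1} =
      ⋃ k ∈ Finset.range (p ^ n), {x : ℚ_[p] | ‖x - (k : ℚ_[p])‖ ≤ (p : ℝ) ^ (-(n : ℤ))} := by
  have hp : (1 : ℝ) ≤ p := mod_cast (Fact.out : p.Prime).one_lt.le
  ext x
  simp only [Set.mem_iUnion, Set.mem_ofPred_eq, Finset.mem_range, exists_prop]
  constructor
  · intro hx
    let z : ℤ_[p] := ⟨x, hx⟩
    refine ⟨z.appr n, z.appr_lt n, ?_⟩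
    have h := (PadicInt.norm_le_pow_iff_mem_span_pow _ n).2 (z.appr_spec n)
    rwa [PadicInt.norm_def, PadicInt.coe_sub, PadicInt.coe_natCast] at h
  · rintro ⟨k, -, hk⟩
    have h := Padic.nonarchimedean (p := p) (x - k) k
    rw [sub_add_cancel] at h
    refine h.trans (max_le (hk.trans (zpow_le_one_of_nonpos₀ hp (by omega))) ?_)
    exact_mod_cast Padic.norm_int_le_one (p := p) (k : ℤ)

lemma Padic.measurableSet_ball [MeasurableSpace ℚ_[p]] [BorelSpace ℚ_[p]] (a : ℚ_[p]) (r : ℝ) :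
    MeasurableSet {x : ℚ_[p] | ‖x - a‖ ≤ r} :=
  (isClosed_le (by fun_prop) continuous_const).measurableSet

lemma Padic.pairwiseDisjoint_ball_natCast (n : ℕ) :
    (Finset.range (p ^ n) : Set ℕ).PairwiseDisjoint
      fun k : ℕ => {x : ℚ_[p] | ‖x - (k : ℚ_[p])‖ ≤ (p : ℝ) ^ (-(n : ℤ))} := by
  intro k hk l hl hkl
  refine Set.disjoint_left.2 fun x hxk hxl => hkl ?_
  simp only [Set.mem_ofPred_eq] at hxk hxl
  have h := Padic.nonarchimedean (p := p) (x - l) (-(x - k))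
  rw [norm_neg] at h
  have h' : ‖(((k : ℤ) - (l : ℤ) : ℤ) : ℚ_[p])‖ ≤ (p : ℝ) ^ (-(n : ℤ)) := by
    push_cast
    rw [show (k : ℚ_[p]) - l = x - l + -(x - k) by ring]
    exact h.trans (max_le hxl hxk)
  rw [Padic.norm_int_le_pow_iff_dvd] at h'
  have hmod : l ≡ k [MOD p ^ n] := (Nat.modEq_iff_dvd).2 (mod_cast h')
  exact (Nat.ModEq.eq_of_lt_of_lt hmod (by simpa using hl) (by simpa using hk)).symm

variable [MeasurableSpace ℚ_[p]] [BorelSpace ℚ_[p]] (μ : Measure ℚ_[p]) [μ.IsAddHaarMeasure]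

lemma Padic.measure_ball_translate (a : ℚ_[p]) (r : ℝ) :
    μ {x : ℚ_[p] | ‖x - a‖ ≤ r} = μ {x : ℚ_[p] | ‖x‖ ≤ r} := by
  simpa [sub_eq_add_neg] using measure_preimage_add_right μ (-a) {x : ℚ_[p] | ‖x‖ ≤ r}

lemma Padic.measureReal_ball (hμ : μ {x : ℚ_[p] | ‖x‖ ≤ 1} = 1) (a : ℚ_[p]) (n : ℕ) :
    μ.real {x : ℚ_[p] | ‖x - a‖ ≤ (p : ℝ) ^ (-(n : ℤ))} = (p : ℝ) ^ (-(n : ℤ)) := by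
  have hp : (p : ℝ) ≠ 0 := mod_cast (Fact.out : p.Prime).ne_zero
  have h := hμ
  rw [Padic.unitBall_eq_biUnion n, measure_biUnion_finset (Padic.pairwiseDisjoint_ball_natCast n)
    fun k _ => Padic.measurableSet_ball _ _] at h
  simp only [Padic.measure_ball_translate, Finset.sum_const, Finset.card_range, nsmul_eq_mul] at h
  rw [measureReal_def, Padic.measure_ball_translate, zpow_neg, zpow_natCast]
  refine eq_inv_of_mul_eq_one_right ?_
  simpa using congrArg ENNReal.toReal h

/-- A function that a translation by an integral element multiplies by a constant `c ≠ 1` has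
integral zero over the unit ball. -/
lemma Padic.setIntegral_unitBall_eq_zero (f : ℚ_[p] → ℂ) (t : ℚ_[p]) (ht : ‖t‖ ≤ 1) (c : ℂ)
    (hc : c ≠ 1) (hf : ∀ x, ‖x‖ ≤ 1 → f (x + t) = c * f x) :
    ∫ x in {x : ℚ_[p] | ‖x‖ ≤ 1}, f x ∂μ = 0 := by
  have hS : MeasurableSet {x : ℚ_[p] | ‖x‖ ≤ 1} := by
    simpa using Padic.measurableSet_ball (p := p) 0 1
  have h := integral_add_right_eq_self (μ := μ) ({x : ℚ_[p] | ‖x‖ ≤ 1}.indicator f) t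
  have hshift : ∀ x, {x : ℚ_[p] | ‖x‖ ≤ 1}.indicator f (x + t) =
      c * {x : ℚ_[p] | ‖x‖ ≤ 1}.indicator f x := by
    intro x
    by_cases hx : ‖x‖ ≤ 1
    · have hxt : ‖x + t‖ ≤ 1 := (Padic.nonarchimedean x t).trans (max_le hx ht)
      rw [Set.indicator_of_mem (by exact hxt), Set.indicator_of_mem (by exact hx), hf x hx]
    · have hxt : ¬ ‖x + t‖ ≤ 1 := fun hxt => hx <| by
        have h := Padic.nonarchimedean (p := p) (x + t) (-t)
        rw [add_neg_cancel_right, norm_neg] at h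
        exact h.trans (max_le hxt ht)
      rw [Set.indicator_of_notMem (by exact hxt), Set.indicator_of_notMem (by exact hx), mul_zero]
  simp only [hshift] at h
  rw [integral_const_mul, integral_indicator hS] at h
  have h' : (c - 1) * ∫ x in {x : ℚ_[p] | ‖x‖ ≤ 1}, f x ∂μ = 0 := by linear_combination h
  exact (mul_eq_zero.1 h').resolve_left (sub_ne_zero.2 hc)

end PadicBalls

/-- A multiplicative function trivial on `1 + p ^ m ℤ_p` takes the same value at a unit `v` and at
any `u` congruent to `v` modulo `p ^ m`. -/
lemma Padic.char_eq_of_norm_sub_le {p : ℕ} [Fact p.Prime] {ω : ℚ_[p] → ℂ}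
    (hωmul : ∀ x y : ℚ_[p], x ≠ 0 → y ≠ 0 → ω (x * y) = ω x * ω y) {m : ℕ}
    (hωm : ∀ u : ℚ_[p], ‖u - 1‖ ≤ (p : ℝ) ^ (-(m : ℤ)) → ω u = 1) {u v : ℚ_[p]}
    (hu : u ≠ 0) (hv : ‖v‖ = 1) (huv : ‖u - v‖ ≤ (p : ℝ) ^ (-(m : ℤ))) : ω u = ω v := by
  have hv0 : v ≠ 0 := norm_ne_zero_iff.1 (by simp [hv])
  have h : ‖u / v - 1‖ ≤ (p : ℝ) ^ (-(m : ℤ)) := by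
    rwa [div_sub_one hv0, norm_div, hv, div_one]
  rw [← div_mul_cancel₀ u hv0, hωmul _ _ (div_ne_zero hu hv0) hv0, hωm _ h, one_mul]

/-- Let `ω` be a ramified continuous character of `ℚ_pˣ` with
conductor exponent `m ≥ 2`, let `0 < j < m` and `y ∈ ℚ_pˣ`.  Then
`∫_{ℤ_p} ω(1 + x p^j) ψ(−xy) dx = 0` unless `v(y) = j − m`, and when
`v(y) = j − m` it equals
`q^{j−m} · ψ(y p^{−j}) · Σ_b ω(b) ψ(−b y p^{−j})`, where `b` runs over any set
of representatives of `U_j / U_m`. -/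
theorem integral_char_one_add_xpj
    {p : ℕ} [Fact p.Prime] [MeasurableSpace ℚ_[p]] [BorelSpace ℚ_[p]]
    (μ : Measure ℚ_[p]) [μ.IsAddHaarMeasure]
    (hμ : μ {x : ℚ_[p] | ‖x‖ ≤ 1} = 1)
    -- ψ : an unramified continuous additive character
    (ψ : ℚ_[p] → ℂ)
    (hψadd : ∀ x y : ℚ_[p], ψ (x + y) = ψ x * ψ y)
    (hψcont : Continuous ψ)
    (hψtriv : ∀ x : ℚ_[p], ‖x‖ ≤ 1 → ψ x = 1)
    (hψntriv : ∃ x : ℚ_[p], ‖x‖ ≤ p ∧ ψ x ≠ 1)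
    -- ω : a continuous multiplicative character of ℚ_pˣ valued in ℂˣ
    (ω : ℚ_[p] → ℂ)
    (hωmul : ∀ x y : ℚ_[p], x ≠ 0 → y ≠ 0 → ω (x * y) = ω x * ω y)
    (hωcont : ContinuousOn ω {x : ℚ_[p] | x ≠ 0})
    (hωne : ∀ x : ℚ_[p], x ≠ 0 → ω x ≠ 0)
    -- m = c(ω) ≥ 2 : ω trivial on U_m but not on U_{m-1}
    (m : ℕ) (hm : 2 ≤ m)
    (hωm : ∀ u : ℚ_[p], ‖u - 1‖ ≤ (p : ℝ) ^ (-(m : ℤ)) → ω u = 1)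
    (hωm' : ¬ ∀ u : ℚ_[p], ‖u - 1‖ ≤ (p : ℝ) ^ (-((m : ℤ) - 1)) → ω u = 1)
    (j : ℕ) (hj0 : 0 < j) (hjm : j < m)
    (y : ℚ_[p]) (hy : y ≠ 0)
    -- B : a set of representatives of U_j / U_m
    (B : Finset ℚ_[p])
    (hB : ∀ b ∈ B, ‖b - 1‖ ≤ (p : ℝ) ^ (-(j : ℤ)))
    (hBrep : ∀ u : ℚ_[p], ‖u - 1‖ ≤ (p : ℝ) ^ (-(j : ℤ)) →
      ∃! b, b ∈ B ∧ ‖u / b - 1‖ ≤ (p : ℝ) ^ (-(m : ℤ))) :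
    (y.valuation ≠ (j : ℤ) - m →
      ∫ x in {x : ℚ_[p] | ‖x‖ ≤ 1},
        ω (1 + x * (p : ℚ_[p]) ^ j) * ψ (-(x * y)) ∂μ = 0) ∧
    (y.valuation = (j : ℤ) - m →
      ∫ x in {x : ℚ_[p] | ‖x‖ ≤ 1},
        ω (1 + x * (p : ℚ_[p]) ^ j) * ψ (-(x * y)) ∂μ =
        (p : ℂ) ^ ((j : ℤ) - m) * ψ (y * (p : ℚ_[p]) ^ (-(j : ℤ))) *
          ∑ b ∈ B, ω b * ψ (-(b * y * (p : ℚ_[p]) ^ (-(j : ℤ))))) := by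
  have hp1 : (1 : ℝ) < p := mod_cast (Fact.out : p.Prime).one_lt
  have hp0 : (0 : ℝ) < p := zero_lt_one.trans hp1
  have hpp : (p : ℚ_[p]) ≠ 0 := mod_cast (Fact.out : p.Prime).ne_zero
  have hpj : (p : ℚ_[p]) ^ j ≠ 0 := pow_ne_zero _ hpp
  have hny : ‖y‖ = (p : ℝ) ^ (-y.valuation) := Padic.norm_eq_zpow_neg_valuation hy
  have mul_le : ∀ {a b : ℚ_[p]} {k l n : ℤ}, ‖a‖ ≤ (p : ℝ) ^ k → ‖b‖ ≤ (p : ℝ) ^ l → k + l ≤ n →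
      ‖a * b‖ ≤ (p : ℝ) ^ n := fun {a b k l n} ha hb h => by
    rw [norm_mul]
    calc ‖a‖ * ‖b‖ ≤ (p : ℝ) ^ k * (p : ℝ) ^ l := by gcongr
      _ = (p : ℝ) ^ (k + l) := (zpow_add₀ hp0.ne' _ _).symm
      _ ≤ (p : ℝ) ^ n := zpow_le_zpow_right₀ hp1.le h
  have hnpj : ‖(p : ℚ_[p]) ^ j‖ ≤ (p : ℝ) ^ (-(j : ℤ)) := (Padic.norm_p_pow j).le
  have hU : ∀ {x : ℚ_[p]}, ‖x‖ ≤ 1 → ‖1 + x * (p : ℚ_[p]) ^ j - 1‖ ≤ (p : ℝ) ^ (-(j : ℤ)) :=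
    fun {x} hx => by
      rw [add_sub_cancel_left]
      exact mul_le (k := 0) (by simpa using hx) hnpj (by omega)
  have norm_one_of : ∀ {u : ℚ_[p]}, ‖u - 1‖ ≤ (p : ℝ) ^ (-(j : ℤ)) → ‖u‖ = 1 := fun hu =>
    Padic.norm_eq_one_of_norm_sub_one_lt_s1 (Padic.norm_sub_one_lt_of_le_zpow hj0 hu)
  have ne_zero_of : ∀ {u : ℚ_[p]}, ‖u - 1‖ ≤ (p : ℝ) ^ (-(j : ℤ)) → u ≠ 0 := fun hu =>
    norm_ne_zero_iff.1 (by simp [norm_one_of hu])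
  constructor
  · intro hv
    rcases lt_or_gt_of_ne hv with hlt | hgt
    · obtain ⟨z, hz, hψz⟩ := hψntriv
      have ht : ‖-(z / y)‖ ≤ (p : ℝ) ^ ((j : ℤ) - m) := by
        rw [norm_neg, div_eq_mul_inv]
        refine mul_le (k := 1) (l := y.valuation) (by simpa using hz) ?_ (by omega)
        rw [norm_inv, hny, zpow_neg, inv_inv]
      have ht1 : ‖-(z / y)‖ ≤ 1 := ht.trans (zpow_le_one_of_nonpos₀ hp1.le (by omega))
      refine Padic.setIntegral_unitBall_eq_zero μ _ _ ht1 (ψ z) hψz fun x hx => ?_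
      have hxt : ‖x + -(z / y)‖ ≤ 1 := (Padic.nonarchimedean _ _).trans (max_le hx ht1)
      rw [Padic.char_eq_of_norm_sub_le hωmul hωm (v := 1 + x * (p : ℚ_[p]) ^ j)
        (ne_zero_of (hU hxt)) (norm_one_of (hU hx)),
        show -((x + -(z / y)) * y) = z + -(x * y) by field_simp; ring, hψadd]
      · ring
      · rw [show 1 + (x + -(z / y)) * (p : ℚ_[p]) ^ j - (1 + x * (p : ℚ_[p]) ^ j) =
          -(z / y) * (p : ℚ_[p]) ^ j by ring]
        exact mul_le ht hnpj (by omega)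
    · push Not at hωm'
      obtain ⟨u, hu, hωu⟩ := hωm'
      obtain ⟨t, rfl⟩ : ∃ t, u = 1 + t * (p : ℚ_[p]) ^ j :=
        ⟨(u - 1) / (p : ℚ_[p]) ^ j, by field_simp; ring⟩
      have ht : ‖t‖ ≤ (p : ℝ) ^ ((j : ℤ) - m + 1) := by
        rw [show t = (1 + t * (p : ℚ_[p]) ^ j - 1) * ((p : ℚ_[p]) ^ j)⁻¹ by field_simp; ring]
        refine mul_le (l := j) hu ?_ (by omega)
        rw [norm_inv, Padic.norm_p_pow, zpow_neg, inv_inv]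
      have ht1 : ‖t‖ ≤ 1 := ht.trans (zpow_le_one_of_nonpos₀ hp1.le (by omega))
      refine Padic.setIntegral_unitBall_eq_zero μ _ _ ht1 _ hωu fun x hx => ?_
      have hxt : ‖x + t‖ ≤ 1 := (Padic.nonarchimedean _ _).trans (max_le hx ht1)
      have hψt : ψ (-(t * y)) = 1 := hψtriv _ <| by
        rw [norm_neg]
        exact (mul_le (n := 0) ht hny.le (by omega)).trans_eq (zpow_zero _)
      rw [Padic.char_eq_of_norm_sub_le hωmul hωm
        (v := (1 + t * (p : ℚ_[p]) ^ j) * (1 + x * (p : ℚ_[p]) ^ j)) (ne_zero_of (hU hxt))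
        (by rw [norm_mul, norm_one_of (hU hx), norm_one_of (hU ht1), one_mul]),
        hωmul _ _ (ne_zero_of (hU ht1)) (ne_zero_of (hU hx)),
        show -((x + t) * y) = -(t * y) + -(x * y) by ring, hψadd, hψt]
      · ring
      · rw [show 1 + (x + t) * (p : ℚ_[p]) ^ j -
            (1 + t * (p : ℚ_[p]) ^ j) * (1 + x * (p : ℚ_[p]) ^ j) =
          (t * (-x * (p : ℚ_[p]) ^ j)) * (p : ℚ_[p]) ^ j by ring]
        refine mul_le (mul_le ht (mul_le (k := 0) ?_ hnpj le_rfl) le_rfl) hnpj (by omega)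
        simpa using hx
  · intro hv
    obtain ⟨n, rfl⟩ : ∃ n, m = j + n := Nat.exists_eq_add_of_le hjm.le
    set S : ℚ_[p] → Set ℚ_[p] := fun b =>
      {x | ‖x - (b - 1) / (p : ℚ_[p]) ^ j‖ ≤ (p : ℝ) ^ (-(n : ℤ))} with hS
    have hS1 : ∀ b ∈ B, ∀ x ∈ S b, ‖x‖ ≤ 1 := by
      intro b hb x hx
      have h := Padic.nonarchimedean (p := p) (x - (b - 1) / (p : ℚ_[p]) ^ j)
        ((b - 1) / (p : ℚ_[p]) ^ j)
      rw [sub_add_cancel] at h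
      refine h.trans (max_le (hx.trans (zpow_le_one_of_nonpos₀ hp1.le (by omega))) ?_)
      rw [norm_div, Padic.norm_p_pow]
      exact div_le_one_of_le₀ (hB b hb) (by positivity)
    have hSb : ∀ {b x : ℚ_[p]}, x ∈ S b ↔
        ‖1 + x * (p : ℚ_[p]) ^ j - b‖ ≤ (p : ℝ) ^ (-((j + n : ℕ) : ℤ)) := by
      intro b x
      rw [show 1 + x * (p : ℚ_[p]) ^ j - b =
        (x - (b - 1) / (p : ℚ_[p]) ^ j) * (p : ℚ_[p]) ^ j by field_simp; ring, norm_mul,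
        Padic.norm_p_pow, Nat.cast_add, neg_add_rev, zpow_add₀ hp0.ne']
      exact (mul_le_mul_iff_left₀ (zpow_pos hp0 (-(j : ℤ)))).symm
    have hSdiv : ∀ {b x : ℚ_[p]}, b ∈ B → (x ∈ S b ↔
        ‖(1 + x * (p : ℚ_[p]) ^ j) / b - 1‖ ≤ (p : ℝ) ^ (-((j + n : ℕ) : ℤ))) := by
      intro b x hb
      rw [hSb, div_sub_one (ne_zero_of (hB b hb)), norm_div, norm_one_of (hB b hb), div_one]
    have hdisj : (B : Set ℚ_[p]).PairwiseDisjoint S := by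
      intro b hb b' hb' hne
      refine Set.disjoint_left.2 fun x hx hx' => hne ?_
      exact (hBrep _ (hU (hS1 b hb x hx))).unique ⟨hb, (hSdiv hb).1 hx⟩ ⟨hb', (hSdiv hb').1 hx'⟩
    have hunion : {x : ℚ_[p] | ‖x‖ ≤ 1} = ⋃ b ∈ B, S b := by
      ext x
      simp only [Set.mem_iUnion, exists_prop]
      refine ⟨fun hx => ?_, fun ⟨b, hb, hx⟩ => hS1 b hb x hx⟩
      obtain ⟨b, ⟨hb, hxb⟩, -⟩ := hBrep _ (hU hx)
      exact ⟨b, hb, (hSdiv hb).2 hxb⟩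
    have hconst : ∀ b ∈ B, Set.EqOn
        (fun x => ω (1 + x * (p : ℚ_[p]) ^ j) * ψ (-(x * y)))
        (fun _ => ω b * (ψ (y * (p : ℚ_[p]) ^ (-(j : ℤ))) *
          ψ (-(b * y * (p : ℚ_[p]) ^ (-(j : ℤ)))))) (S b) := by
      intro b hb x hx
      have hψx : ψ (-(x - (b - 1) / (p : ℚ_[p]) ^ j) * y) = 1 := hψtriv _ <| by
        refine (mul_le (n := 0) (k := -n) ?_ hny.le (by omega)).trans_eq (zpow_zero _)
        rw [norm_neg]
        exact hx
      simp only
      rw [Padic.char_eq_of_norm_sub_le hωmul hωm (ne_zero_of (hU (hS1 b hb x hx)))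
        (norm_one_of (hB b hb)) (hSb.1 hx), ← hψadd,
        show -(x * y) = -(x - (b - 1) / (p : ℚ_[p]) ^ j) * y +
          (y * (p : ℚ_[p]) ^ (-(j : ℤ)) + -(b * y * (p : ℚ_[p]) ^ (-(j : ℤ)))) by
          rw [zpow_neg, zpow_natCast]; field_simp; ring,
        hψadd (-(x - (b - 1) / (p : ℚ_[p]) ^ j) * y), hψx, one_mul]
    have hmeas : ∀ b ∈ B, MeasurableSet (S b) := fun b _ => Padic.measurableSet_ball _ _
    have hint : ∀ b ∈ B, IntegrableOn
        (fun x => ω (1 + x * (p : ℚ_[p]) ^ j) * ψ (-(x * y))) (S b) μ := by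
      intro b hb
      refine (integrableOn_const ?_).congr_fun (hconst b hb).symm (hmeas b hb)
      refine ((measure_mono (hS1 b hb)).trans_lt ?_).ne
      exact hμ.trans_lt ENNReal.one_lt_top
    rw [hunion, integral_biUnion_finset B hmeas hdisj hint, Finset.mul_sum]
    refine Finset.sum_congr rfl fun b hb => ?_
    rw [setIntegral_congr_fun (hmeas b hb) (hconst b hb), setIntegral_const, hS,
      Padic.measureReal_ball μ hμ, Complex.real_smul,
      show (j : ℤ) - ((j + n : ℕ) : ℤ) = -(n : ℤ) by omega]
    push_cast
    ring
end

section
/- Let x ∈ ℚ_p and y ∈ ℚ_pˣ with x + y ≠ 0, and let g be the 2×2 matrix [[−1, −1], [y+x, x]]. (i) If v(x+y) ≤ v(y), then y/(x+y) ∈ ℤ_p and g = [[y/(x+y), −1 − y/(x+y)], [0, y+x]] · [[1, 0], [1, 1]] · [[1, −y/(x+y)], [0, 1]]. (ii) If r := v((x+y)/y) ≥ 1, then x ≠ 0, x/y ∈ ℤ_pˣ and (x+y)/(x p^r) ∈ ℤ_pˣ, and g = [[y p^r/(x+y), −1], [0, x]] · [[1, 0], [p^r, 1]] · [[(x+y)/(x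 p^r), 0], [0, 1]]. -/
/-- Iwasawa-type decompositions of the matrix
`[[−1, −1], [y+x, x]]` over `ℚ_p`, according to whether `v(x+y) ≤ v(y)`
or `r := v((x+y)/y) ≥ 1`. -/
theorem matrix_decomposition_j_eq_zero
    {p : ℕ} [Fact p.Prime] (x y : ℚ_[p]) (hy : y ≠ 0) (hxy : x + y ≠ 0) :
    -- (i)
    ((x + y).valuation ≤ y.valuation →
      ‖y / (x + y)‖ ≤ 1 ∧
      (!![(-1 : ℚ_[p]), -1; y + x, x] =
        !![y / (x + y), -1 - y / (x + y); 0, y + x] *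
          !![1, 0; 1, 1] * !![1, -(y / (x + y)); 0, 1])) ∧
    -- (ii)
    (1 ≤ ((x + y) / y).valuation →
      x ≠ 0 ∧ ‖x / y‖ = 1 ∧
      ‖(x + y) / (x * (p : ℚ_[p]) ^ ((x + y) / y).valuation)‖ = 1 ∧
      (!![(-1 : ℚ_[p]), -1; y + x, x] =
        !![y * (p : ℚ_[p]) ^ ((x + y) / y).valuation / (x + y), -1; 0, x] *
          !![1, 0; (p : ℚ_[p]) ^ ((x + y) / y).valuation, 1] *
          !![(x + y) / (x * (p : ℚ_[p]) ^ ((x + y) / y).valuation), 0; 0, 1])) := by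
  refine ⟨fun h => ⟨?_, ?_⟩, fun h => ?_⟩
  · rw [Padic.norm_le_one_iff_val_nonneg, div_eq_mul_inv,
      Padic.valuation_mul hy (inv_ne_zero hxy), Padic.valuation_inv]
    omega
  · ext i j
    fin_cases i <;> fin_cases j <;> simp [Matrix.mul_apply, Fin.sum_univ_two]
    rw [add_comm y x]
    field_simp
    ring
  · have hp : (p : ℚ_[p]) ≠ 0 := mod_cast (Fact.out : p.Prime).ne_zero
    have hnorm : ‖(x + y) / y‖ = (p : ℝ) ^ (-((x + y) / y).valuation) :=
      Padic.norm_eq_zpow_neg_valuation (div_ne_zero hxy hy)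
    have hlt : ‖(x + y) / y‖ < 1 := by
      rw [hnorm]
      exact zpow_lt_one_of_neg₀ (mod_cast (Fact.out : p.Prime).one_lt) (by omega)
    have hunit : ‖x / y‖ = 1 := by
      have hsplit : x / y = (x + y) / y + -1 := by
        field_simp
        ring
      rw [hsplit, Padic.add_eq_max_of_ne (by simpa using hlt.ne), norm_neg, norm_one,
        max_eq_right hlt.le]
    have hx : x ≠ 0 := by
      rintro rfl
      simp at hunit
    have hpow : (p : ℚ_[p]) ^ ((x + y) / y).valuation ≠ 0 := zpow_ne_zero _ hp
    refine ⟨hx, hunit, ?_, ?_⟩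
    · have hquot : (x + y) / (x * (p : ℚ_[p]) ^ ((x + y) / y).valuation) =
          (x + y) / y / (x / y * (p : ℚ_[p]) ^ ((x + y) / y).valuation) := by
        generalize (p : ℚ_[p]) ^ ((x + y) / y).valuation = q at hpow
        field_simp
      rw [hquot, norm_div, norm_mul, hunit, one_mul, Padic.norm_p_zpow, ← hnorm]
      exact div_self (norm_ne_zero_iff.mpr (div_ne_zero hxy hy))
    · generalize (p : ℚ_[p]) ^ ((x + y) / y).valuation = q at hpow
      ext i j
      fin_cases i <;> fin_cases j <;> simp [Matrix.mul_apply, Fin.sum_univ_two]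
      · field_simp
        ring
      · field_simp
        ring
end

section
/- Let j ≥ 1 be an integer, let x, y ∈ ℚ_pˣ with y + x p^j ≠ 0, let g be the 2×2 matrix [[−p^j, −1], [y + x p^j, x]], and set r := v(y/x + p^j). (i) If r ≤ 0, then x/(y + x p^j) ∈ ℤ_p and g = [[y/(y+x p^j), −y/(y+x p^j) − p^j], [0, y+x p^j]] · [[1, 0], [1, 1]] · [[1, x/(y+x p^j) − 1], [0, 1]]. (ii) If r ≥ 1, then (y/x + p^j) p^{−r} ∈ ℤ_pˣ and g = [[y p^r/(y+x p^j), −1], [0, x]] · [[1, 0], [p^r, 1]] · [[(y/x + p^j) p^{−r}, 0], [0, 1]]. -/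
/-- Iwasawa-type decompositions of the matrix
`[[−p^j, −1], [y + x p^j, x]]` over `ℚ_p` (for `j ≥ 1`), according to whether
`r := v(y/x + p^j)` satisfies `r ≤ 0` or `r ≥ 1`. -/
theorem matrix_decomposition_j_pos
    {p : ℕ} [Fact p.Prime] (j : ℕ) (hj : 1 ≤ j) (x y : ℚ_[p])
    (hx : x ≠ 0) (hy : y ≠ 0) (hxy : y + x * (p : ℚ_[p]) ^ j ≠ 0) :
    -- (i)
    ((y / x + (p : ℚ_[p]) ^ j).valuation ≤ 0 →
      ‖x / (y + x * (p : ℚ_[p]) ^ j)‖ ≤ 1 ∧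
      (!![-(p : ℚ_[p]) ^ j, -1; y + x * (p : ℚ_[p]) ^ j, x] =
        !![y / (y + x * (p : ℚ_[p]) ^ j),
            -(y / (y + x * (p : ℚ_[p]) ^ j)) - (p : ℚ_[p]) ^ j;
            0, y + x * (p : ℚ_[p]) ^ j] *
          !![1, 0; 1, 1] *
          !![1, x / (y + x * (p : ℚ_[p]) ^ j) - 1; 0, 1])) ∧
    -- (ii)
    (1 ≤ (y / x + (p : ℚ_[p]) ^ j).valuation →
      ‖(y / x + (p : ℚ_[p]) ^ j) *
          (p : ℚ_[p]) ^ (-(y / x + (p : ℚ_[p]) ^ j).valuation)‖ = 1 ∧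
      (!![-(p : ℚ_[p]) ^ j, -1; y + x * (p : ℚ_[p]) ^ j, x] =
        !![y * (p : ℚ_[p]) ^ (y / x + (p : ℚ_[p]) ^ j).valuation /
            (y + x * (p : ℚ_[p]) ^ j), -1; 0, x] *
          !![1, 0; (p : ℚ_[p]) ^ (y / x + (p : ℚ_[p]) ^ j).valuation, 1] *
          !![(y / x + (p : ℚ_[p]) ^ j) *
              (p : ℚ_[p]) ^ (-(y / x + (p : ℚ_[p]) ^ j).valuation), 0; 0, 1])) := by
  have hp : (p : ℚ_[p]) ≠ 0 := Nat.cast_ne_zero.mpr (Fact.out : p.Prime).ne_zero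
  have hdiv : y / x + (p : ℚ_[p]) ^ j = (y + x * (p : ℚ_[p]) ^ j) / x := by
    field_simp
  rw [hdiv]
  generalize hr : ((y + x * (p : ℚ_[p]) ^ j) / x).valuation = r
  have hq : (p : ℚ_[p]) ^ r ≠ 0 := zpow_ne_zero r hp
  refine ⟨fun h => ⟨?_, ?_⟩, fun _ => ⟨?_, ?_⟩⟩
  · rw [Padic.norm_le_one_iff_val_nonneg, ← inv_div, Padic.valuation_inv, hr]
    lia
  · ext a b
    fin_cases a <;> fin_cases b <;> simp [Matrix.mul_apply, Fin.sum_univ_two]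
    all_goals field_simp
    all_goals ring
  · have hp' : (p : ℝ) ≠ 0 := Nat.cast_ne_zero.mpr (Fact.out : p.Prime).ne_zero
    rw [norm_mul, Padic.norm_p_zpow, Padic.norm_eq_zpow_neg_valuation (div_ne_zero hxy hx), hr,
      ← zpow_add₀ hp']
    simp
  · rw [zpow_neg]
    generalize (p : ℚ_[p]) ^ r = q at hq ⊢
    generalize hd : y + x * (p : ℚ_[p]) ^ j = d at hxy ⊢
    ext a b
    fin_cases a <;> fin_cases b <;> simp [Matrix.mul_apply, Fin.sum_univ_two]
    all_goals field_simp
    rw [← hd]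
    ring
end

section
/- For every integer n, the function x ↦ |x|^{−2} ψ(−x) is integrable on the set {x ∈ ℚ_pˣ : v(x) ≤ n}, and ∫_{{x ≠ 0, v(x) ≤ n}} |x|^{−2} ψ(−x) dx = q^n − q^{−1} − q^{−2} when n ≥ −1, and = 0 when n ≤ −2. -/
open MeasureTheory

namespace MeasureTheory

/-- An integral over a translation-invariant set vanishes when the translation multiplies the
integrand by a constant different from `1`. -/
lemma setIntegral_eq_zero_of_add_right_eq_mul {G : Type*} [MeasurableSpace G] [AddGroup G]
    [MeasurableAdd G] {μ : Measure G} [μ.IsAddRightInvariant] {s : Set G} (hs : MeasurableSet s)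
    {f : G → ℂ} {y : G} {c : ℂ} (hc : c ≠ 1) (hsy : ∀ x, x + y ∈ s ↔ x ∈ s)
    (hf : ∀ x ∈ s, f (x + y) = c * f x) : ∫ x in s, f x ∂μ = 0 := by
  rw [← integral_indicator hs]
  have h := integral_add_right_eq_self (μ := μ) (s.indicator f) y
  have hmul : ∀ x, s.indicator f (x + y) = c * s.indicator f x := fun x ↦ by
    by_cases hx : x ∈ s
    · rw [Set.indicator_of_mem ((hsy x).2 hx), Set.indicator_of_mem hx, hf x hx]
    · rw [Set.indicator_of_notMem (mt (hsy x).1 hx), Set.indicator_of_notMem hx, mul_zero]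
  simp_rw [hmul] at h
  rw [integral_const_mul] at h
  have h' : (c - 1) * ∫ x, s.indicator f x ∂μ = 0 := by rw [sub_mul, h, one_mul, sub_self]
  exact (mul_eq_zero.1 h').resolve_left (sub_ne_zero.2 hc)

end MeasureTheory

namespace Padic

variable {p : ℕ} [hp : Fact p.Prime]

lemma one_lt_natCast_prime : (1 : ℝ) < p := mod_cast hp.out.one_lt

lemma setOf_ne_zero_and_valuation_le (n : ℤ) :
    {x : ℚ_[p] | x ≠ 0 ∧ x.valuation ≤ n} = {x | (p : ℝ) ^ (-n) ≤ ‖x‖} := by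
  have h1 := one_lt_natCast_prime (p := p)
  ext x
  by_cases hx : x = 0
  · have : (0 : ℝ) < (p : ℝ) ^ (-n) := by positivity
    simpa [hx] using this
  · simp only [Set.mem_ofPred_eq, ne_eq, hx, not_false_eq_true, true_and]
    rw [norm_eq_zpow_neg_valuation hx, zpow_le_zpow_iff_right₀ h1, neg_le_neg_iff]

lemma exists_nat_norm_sub_le {k : ℤ} {x : ℚ_[p]} (hx : ‖x‖ ≤ (p : ℝ) ^ (k + 1)) :
    ∃ i < p, ‖x - i * (p : ℚ_[p]) ^ (-(k + 1))‖ ≤ (p : ℝ) ^ k := by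
  have h0 : (0 : ℝ) < p := zero_lt_one.trans one_lt_natCast_prime
  have hp0 : (p : ℚ_[p]) ≠ 0 := mod_cast hp.out.ne_zero
  have hz : ‖(p : ℚ_[p]) ^ (k + 1) * x‖ ≤ 1 := by
    rw [norm_mul, norm_p_zpow, zpow_neg]
    exact inv_mul_le_one_of_le₀ hx (by positivity)
  let z : ℤ_[p] := ⟨_, hz⟩
  refine ⟨z.zmodRepr, z.zmodRepr_lt_p, ?_⟩
  have hlt := z.norm_sub_zmodRepr_lt_one
  rw [PadicInt.norm_def] at hlt
  push_cast at hlt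
  rw [norm_le_pow_iff_norm_lt_pow_add_one]
  have e : x - z.zmodRepr * (p : ℚ_[p]) ^ (-(k + 1)) =
      (p : ℚ_[p]) ^ (-(k + 1)) * ((z : ℚ_[p]) - z.zmodRepr) := by
    have : (z : ℚ_[p]) = (p : ℚ_[p]) ^ (k + 1) * x := rfl
    rw [this, mul_sub, ← mul_assoc, ← zpow_add₀ hp0]
    simp [mul_comm]
  rw [e, norm_mul, norm_p_zpow, neg_neg]
  exact mul_lt_of_lt_one_right (by positivity) hlt

lemma nat_eq_of_norm_sub_le {k : ℤ} {x : ℚ_[p]} {i j : ℕ} (hi : i < p) (hj : j < p)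
    (hxi : ‖x - i * (p : ℚ_[p]) ^ (-(k + 1))‖ ≤ (p : ℝ) ^ k)
    (hxj : ‖x - j * (p : ℚ_[p]) ^ (-(k + 1))‖ ≤ (p : ℝ) ^ k) : i = j := by
  have h0 : (0 : ℝ) < p := zero_lt_one.trans one_lt_natCast_prime
  have h : ‖((i - j : ℤ) : ℚ_[p]) * (p : ℚ_[p]) ^ (-(k + 1))‖ ≤ (p : ℝ) ^ k := by
    have e : ((i - j : ℤ) : ℚ_[p]) * (p : ℚ_[p]) ^ (-(k + 1)) =
        (x - j * (p : ℚ_[p]) ^ (-(k + 1))) - (x - i * (p : ℚ_[p]) ^ (-(k + 1))) := by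
      push_cast; ring
    rw [e]
    rw [sub_eq_add_neg]
    exact (nonarchimedean _ _).trans (max_le hxj (by rwa [norm_neg]))
  rw [norm_le_pow_iff_norm_lt_pow_add_one, norm_mul, norm_p_zpow, neg_neg,
    mul_lt_iff_lt_one_left (by positivity), norm_intCast_lt_one_iff] at h
  have := Int.eq_zero_of_abs_lt_dvd h (abs_lt.2 ⟨by omega, by omega⟩)
  omega

lemma setOf_zpow_le_norm_eq_union (m : ℤ) :
    {x : ℚ_[p] | (p : ℝ) ^ (-(m + 1)) ≤ ‖x‖} =
      {x | (p : ℝ) ^ (-m) ≤ ‖x‖} ∪ {x | ‖x‖ = (p : ℝ) ^ (-(m + 1))} := by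
  ext x
  have h := norm_lt_pow_iff_norm_le_pow_sub_one x (-m)
  rw [show -m - 1 = -(m + 1) by ring] at h
  simp only [Set.mem_ofPred_eq, Set.mem_union, ← not_lt (b := (p : ℝ) ^ (-m)), h]
  grind

lemma disjoint_setOf_zpow_le_norm (m : ℤ) :
    Disjoint {x : ℚ_[p] | (p : ℝ) ^ (-m) ≤ ‖x‖} {x | ‖x‖ = (p : ℝ) ^ (-(m + 1))} := by
  refine Set.disjoint_left.2 fun x (hx : _ ≤ ‖x‖) (hx' : ‖x‖ = _) ↦ hx.not_gt ?_
  rw [hx']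
  exact zpow_lt_zpow_right₀ one_lt_natCast_prime (by omega)

lemma setOf_zpow_le_norm_eq_iUnion (n : ℤ) :
    {x : ℚ_[p] | (p : ℝ) ^ (-n) ≤ ‖x‖} = ⋃ i : ℕ, {x | ‖x‖ = (p : ℝ) ^ (-n + i)} := by
  have h1 := one_lt_natCast_prime (p := p)
  ext x
  simp only [Set.mem_ofPred_eq, Set.mem_iUnion]
  constructor
  · intro hx
    have hx0 : x ≠ 0 := norm_pos_iff.1 (lt_of_lt_of_le (by positivity) hx)
    rw [norm_eq_zpow_neg_valuation hx0] at hx ⊢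
    rw [zpow_le_zpow_iff_right₀ h1] at hx
    exact ⟨(-x.valuation + n).toNat, by congr 1; omega⟩
  · rintro ⟨i, hi⟩
    rw [hi]
    exact zpow_le_zpow_right₀ h1.le (by omega)

lemma norm_eq_one_of_map_add_eq_mul {ψ : ℚ_[p] → ℂ}
    (hadd : ∀ x y : ℚ_[p], ψ (x + y) = ψ x * ψ y)
    (htriv : ∀ x : ℚ_[p], ‖x‖ ≤ 1 → ψ x = 1) (x : ℚ_[p]) : ‖ψ x‖ = 1 := by
  have h1 := one_lt_natCast_prime (p := p)
  have hpow (k : ℕ) : ψ (k * x) = ψ x ^ k := by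
    induction k with
    | zero => simpa using htriv 0 (by simp)
    | succ k ih => rw [Nat.cast_succ, add_mul, one_mul, hadd, ih, pow_succ]
  obtain ⟨m, hm⟩ := pow_unbounded_of_one_lt ‖x‖ h1
  have h : ψ x ^ p ^ m = 1 := by
    rw [← hpow]
    refine htriv _ ?_
    rw [norm_mul, Nat.cast_pow, norm_p_pow, zpow_neg, zpow_natCast]
    exact inv_mul_le_one_of_le₀ hm.le (by positivity)
  exact Complex.norm_eq_one_of_pow_eq_one h (pow_ne_zero _ hp.out.ne_zero)

variable [MeasurableSpace ℚ_[p]]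

section Measurable

variable [BorelSpace ℚ_[p]]

lemma measurableSet_norm_le (r : ℝ) : MeasurableSet {x : ℚ_[p] | ‖x‖ ≤ r} :=
  measurableSet_le measurable_norm measurable_const

lemma measurableSet_norm_ge (r : ℝ) : MeasurableSet {x : ℚ_[p] | r ≤ ‖x‖} :=
  measurableSet_le measurable_const measurable_norm

lemma measurableSet_norm_eq (r : ℝ) : MeasurableSet {x : ℚ_[p] | ‖x‖ = r} :=
  measurableSet_eq_fun measurable_norm measurable_const

end Measurable

variable (μ : Measure ℚ_[p]) [μ.IsAddHaarMeasure]

lemma measure_norm_le_ne_top (r : ℝ) : μ {x : ℚ_[p] | ‖x‖ ≤ r} ≠ ⊤ := by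
  have := (isCompact_closedBall (0 : ℚ_[p]) r).measure_lt_top (μ := μ)
  simpa [Metric.closedBall, dist_zero_right] using this.ne

lemma measure_norm_eq_ne_top (r : ℝ) : μ {x : ℚ_[p] | ‖x‖ = r} ≠ ⊤ :=
  measure_ne_top_of_subset (fun _ hx ↦ le_of_eq hx) (measure_norm_le_ne_top μ r)

variable [BorelSpace ℚ_[p]]

lemma measureReal_norm_le_zpow_add_one (k : ℤ) :
    μ.real {x : ℚ_[p] | ‖x‖ ≤ (p : ℝ) ^ (k + 1)} = p * μ.real {x : ℚ_[p] | ‖x‖ ≤ (p : ℝ) ^ k} := by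
  have h1 := one_lt_natCast_prime (p := p)
  have hpre (i : ℕ) : {x : ℚ_[p] | ‖x - i * (p : ℚ_[p]) ^ (-(k + 1))‖ ≤ (p : ℝ) ^ k} =
      (fun x ↦ x + -(i * (p : ℚ_[p]) ^ (-(k + 1)))) ⁻¹' {x | ‖x‖ ≤ (p : ℝ) ^ k} := by
    ext x; simp [sub_eq_add_neg]
  have hμi (i : ℕ) : μ {x : ℚ_[p] | ‖x - i * (p : ℚ_[p]) ^ (-(k + 1))‖ ≤ (p : ℝ) ^ k} =
      μ {x | ‖x‖ ≤ (p : ℝ) ^ k} := by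
    rw [hpre, measure_preimage_add_right]
  have hunion : {x : ℚ_[p] | ‖x‖ ≤ (p : ℝ) ^ (k + 1)} = ⋃ i ∈ Finset.range p,
      {x : ℚ_[p] | ‖x - i * (p : ℚ_[p]) ^ (-(k + 1))‖ ≤ (p : ℝ) ^ k} := by
    ext x
    simp only [Set.mem_iUnion, Finset.mem_range, exists_prop, Set.mem_ofPred_eq]
    refine ⟨exists_nat_norm_sub_le, fun ⟨i, _, hx⟩ ↦ ?_⟩
    rw [← sub_add_cancel x (i * (p : ℚ_[p]) ^ (-(k + 1)))]
    refine (nonarchimedean _ _).trans (max_le (hx.trans ?_) ?_)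
    · exact zpow_le_zpow_right₀ h1.le (by omega)
    · rw [norm_mul, norm_p_zpow, neg_neg]
      exact mul_le_of_le_one_left (by positivity) (mod_cast norm_int_le_one (p := p) (i : ℤ))
  have hdisj : Set.PairwiseDisjoint (Finset.range p : Set ℕ)
      (fun i : ℕ ↦ {x : ℚ_[p] | ‖x - i * (p : ℚ_[p]) ^ (-(k + 1))‖ ≤ (p : ℝ) ^ k}) :=
    fun i hi j hj hij ↦ Set.disjoint_left.2 fun x hxi hxj ↦
      hij (nat_eq_of_norm_sub_le (by simpa using hi) (by simpa using hj) hxi hxj)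
  have hmeas : ∀ i ∈ Finset.range p,
      MeasurableSet {x : ℚ_[p] | ‖x - i * (p : ℚ_[p]) ^ (-(k + 1))‖ ≤ (p : ℝ) ^ k} := fun i _ ↦
    measurableSet_le (measurable_id.sub_const _).norm measurable_const
  rw [measureReal_def, hunion, measure_biUnion_finset hdisj hmeas]
  simp only [hμi, Finset.sum_const, Finset.card_range, nsmul_eq_mul, ENNReal.toReal_mul,
    ENNReal.toReal_natCast, measureReal_def]

lemma measureReal_norm_le_zpow (hμ : μ {x : ℚ_[p] | ‖x‖ ≤ 1} = 1) (k : ℤ) :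
    μ.real {x : ℚ_[p] | ‖x‖ ≤ (p : ℝ) ^ k} = (p : ℝ) ^ k := by
  have h0 : (p : ℝ) ≠ 0 := (zero_lt_one.trans one_lt_natCast_prime).ne'
  induction k using Int.induction_on with
  | zero => simp [measureReal_def, hμ]
  | succ k ih => rw [measureReal_norm_le_zpow_add_one, ih, zpow_add_one₀ h0, mul_comm]
  | pred k ih =>
    have h := measureReal_norm_le_zpow_add_one μ (-(k : ℤ) - 1)
    rw [sub_add_cancel, ih] at h
    refine mul_left_cancel₀ h0 (h.symm.trans ?_)
    rw [zpow_sub_one₀ h0, mul_comm, inv_mul_cancel_right₀ h0]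

lemma measureReal_norm_eq_zpow (hμ : μ {x : ℚ_[p] | ‖x‖ ≤ 1} = 1) (k : ℤ) :
    μ.real {x : ℚ_[p] | ‖x‖ = (p : ℝ) ^ k} = (p : ℝ) ^ k - (p : ℝ) ^ (k - 1) := by
  have h1 := one_lt_natCast_prime (p := p)
  have e : {x : ℚ_[p] | ‖x‖ = (p : ℝ) ^ k} =
      {x | ‖x‖ ≤ (p : ℝ) ^ k} \ {x | ‖x‖ ≤ (p : ℝ) ^ (k - 1)} := by
    ext x
    simp only [Set.mem_ofPred_eq, Set.mem_sdiff, ← norm_lt_pow_iff_norm_le_pow_sub_one, not_lt]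
    exact le_antisymm_iff
  have hsub : {x : ℚ_[p] | ‖x‖ ≤ (p : ℝ) ^ (k - 1)} ⊆ {x | ‖x‖ ≤ (p : ℝ) ^ k} :=
    fun x hx ↦ le_trans hx (zpow_le_zpow_right₀ h1.le (by omega))
  rw [e, measureReal_sdiff hsub
    (measurableSet_norm_le _) (measure_norm_le_ne_top μ _),
    measureReal_norm_le_zpow μ hμ, measureReal_norm_le_zpow μ hμ]

lemma integrableOn_inv_norm_sq_mul (hμ : μ {x : ℚ_[p] | ‖x‖ ≤ 1} = 1) {g : ℚ_[p] → ℂ}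
    (hg : Continuous g) (hg1 : ∀ x, ‖g x‖ = 1)
    (n : ℤ) : IntegrableOn (fun x : ℚ_[p] ↦ ((‖x‖⁻¹ ^ 2 : ℝ) : ℂ) * g x)
      {x | (p : ℝ) ^ (-n) ≤ ‖x‖} μ := by
  have h0 : (0 : ℝ) < p := zero_lt_one.trans one_lt_natCast_prime
  have hnorm (x : ℚ_[p]) : ‖((‖x‖⁻¹ ^ 2 : ℝ) : ℂ) * g x‖ = ‖x‖⁻¹ ^ 2 := by
    rw [norm_mul, hg1, mul_one, Complex.norm_real, Real.norm_of_nonneg (by positivity)]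
  have hmeas : Measurable fun x : ℚ_[p] ↦ ((‖x‖⁻¹ ^ 2 : ℝ) : ℂ) * g x :=
    (Complex.measurable_ofReal.comp (measurable_norm.inv.pow_const 2)).mul hg.measurable
  rw [setOf_zpow_le_norm_eq_iUnion]
  refine integrableOn_iUnion_of_summable_integral_norm (fun i ↦ ?_) ?_
  · refine Measure.integrableOn_of_bounded (M := ((p : ℝ) ^ (-n + i : ℤ))⁻¹ ^ 2)
      (measure_norm_eq_ne_top μ _) hmeas.aestronglyMeasurable ?_
    refine ae_restrict_of_forall_mem (measurableSet_norm_eq _) fun x (hx : ‖x‖ = _) ↦ ?_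
    rw [hnorm, hx]
  · have hint (i : ℕ) : ∫ x in {x : ℚ_[p] | ‖x‖ = (p : ℝ) ^ (-n + i)},
        ‖((‖x‖⁻¹ ^ 2 : ℝ) : ℂ) * g x‖ ∂μ = (p : ℝ) ^ n * (1 - (p : ℝ)⁻¹) * (p : ℝ)⁻¹ ^ i := by
      rw [setIntegral_congr_fun (g := fun _ ↦ ((p : ℝ) ^ (-n + i : ℤ))⁻¹ ^ 2)
        (measurableSet_norm_eq _) fun x (hx : ‖x‖ = _) ↦ (hnorm x).trans (by rw [hx]),
        setIntegral_const, measureReal_norm_eq_zpow μ hμ, smul_eq_mul, zpow_sub_one₀ h0.ne',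
        zpow_add₀ h0.ne', zpow_neg, zpow_natCast, inv_pow _ i]
      field_simp
    simp_rw [hint]
    exact (summable_geometric_of_lt_one (by positivity)
      (inv_lt_one_of_one_lt₀ one_lt_natCast_prime)).mul_left _

end Padic

open Padic

/-- For every integer `n`, the function `x ↦ |x|^{−2} ψ(−x)`
is integrable on `{x ∈ ℚ_pˣ : v(x) ≤ n}`, and its integral there equals
`q^n − q^{−1} − q^{−2}` when `n ≥ −1` and `0` when `n ≤ −2`. -/
theorem integral_inv_norm_sq_addChar
    {p : ℕ} [Fact p.Prime] [MeasurableSpace ℚ_[p]] [BorelSpace ℚ_[p]]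
    (μ : Measure ℚ_[p]) [μ.IsAddHaarMeasure]
    (hμ : μ {x : ℚ_[p] | ‖x‖ ≤ 1} = 1)
    -- ψ : an unramified continuous additive character
    (ψ : ℚ_[p] → ℂ)
    (hψadd : ∀ x y : ℚ_[p], ψ (x + y) = ψ x * ψ y)
    (hψcont : Continuous ψ)
    (hψtriv : ∀ x : ℚ_[p], ‖x‖ ≤ 1 → ψ x = 1)
    (hψntriv : ∃ x : ℚ_[p], ‖x‖ ≤ p ∧ ψ x ≠ 1)
    (n : ℤ) :
    IntegrableOn (fun x : ℚ_[p] => ((‖x‖⁻¹ ^ 2 : ℝ) : ℂ) * ψ (-x))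
      {x : ℚ_[p] | x ≠ 0 ∧ x.valuation ≤ n} μ ∧
    (-1 ≤ n →
      ∫ x in {x : ℚ_[p] | x ≠ 0 ∧ x.valuation ≤ n},
          ((‖x‖⁻¹ ^ 2 : ℝ) : ℂ) * ψ (-x) ∂μ =
        (p : ℂ) ^ n - (p : ℂ)⁻¹ - ((p : ℂ) ^ (2 : ℕ))⁻¹) ∧
    (n ≤ -2 →
      ∫ x in {x : ℚ_[p] | x ≠ 0 ∧ x.valuation ≤ n},
          ((‖x‖⁻¹ ^ 2 : ℝ) : ℂ) * ψ (-x) ∂μ = 0) := by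
  have h1 := one_lt_natCast_prime (p := p)
  have h0 : (p : ℂ) ≠ 0 := mod_cast (Fact.out : p.Prime).ne_zero
  have hψnorm := norm_eq_one_of_map_add_eq_mul hψadd hψtriv
  have hint (m : ℤ) := integrableOn_inv_norm_sq_mul μ hμ (hψcont.comp continuous_neg)
    (fun x ↦ hψnorm (-x)) m
  simp only [Function.comp_apply] at hint
  obtain ⟨y, hy, hψy⟩ := hψntriv
  have hψsub (x : ℚ_[p]) : ψ (-(x + -y)) = ψ y * ψ (-x) := by
    rw [← hψadd]; congr 1; ring
  simp only [setOf_ne_zero_and_valuation_le]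
  have hzero (m : ℤ) (hm : m ≤ -2) :
      ∫ x in {x : ℚ_[p] | (p : ℝ) ^ (-m) ≤ ‖x‖}, ((‖x‖⁻¹ ^ 2 : ℝ) : ℂ) * ψ (-x) ∂μ = 0 := by
    have hlt : ‖-y‖ < (p : ℝ) ^ (-m) := by
      rw [norm_neg]
      exact hy.trans_lt (by simpa using zpow_lt_zpow_right₀ h1 (show 1 < -m by omega))
    have hadd (x : ℚ_[p]) (hx : (p : ℝ) ^ (-m) ≤ ‖x‖) : ‖x + -y‖ = ‖x‖ := by
      have := hlt.trans_le hx
      rw [add_eq_max_of_ne this.ne', max_eq_left this.le]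
    refine setIntegral_eq_zero_of_add_right_eq_mul (measurableSet_norm_ge _) (y := -y) hψy
      (fun x ↦ ⟨fun hx ↦ ?_, fun hx ↦ ?_⟩) fun x hx ↦ ?_
    · by_contra! hx'
      exact (lt_of_le_of_lt (nonarchimedean x (-y)) (max_lt (not_le.1 hx') hlt)).not_ge hx
    · exact hx.trans_eq (hadd x hx).symm
    · rw [hadd x hx, hψsub]
      ring
  have hsphere (k : ℤ) (hk : k ≤ 0) : ∫ x in {x : ℚ_[p] | ‖x‖ = (p : ℝ) ^ k},
      ((‖x‖⁻¹ ^ 2 : ℝ) : ℂ) * ψ (-x) ∂μ = (p : ℂ) ^ (-k) - (p : ℂ) ^ (-k - 1) := by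
    rw [setIntegral_congr_fun (g := fun _ ↦ (((p : ℝ) ^ k)⁻¹ ^ 2 : ℂ)) (measurableSet_norm_eq _),
      setIntegral_const, measureReal_norm_eq_zpow μ hμ, Complex.real_smul]
    · push_cast
      rw [zpow_sub_one₀ h0, zpow_sub_one₀ h0, zpow_neg]
      field_simp
    · intro x (hx : ‖x‖ = _)
      have : ‖-x‖ ≤ 1 := by
        rw [norm_neg, hx]
        exact zpow_le_one_of_nonpos₀ h1.le hk
      simp [hψtriv _ this, hx]
  have hsphere_one : ∫ x in {x : ℚ_[p] | ‖x‖ = (p : ℝ) ^ (1 : ℤ)},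
      ((‖x‖⁻¹ ^ 2 : ℝ) : ℂ) * ψ (-x) ∂μ = -((p : ℂ) ^ 2)⁻¹ := by
    have hset : {x : ℚ_[p] | ‖x‖ = (p : ℝ) ^ (1 : ℤ)} = {x | ‖x‖ ≤ p} \ {x | ‖x‖ ≤ 1} := by
      ext x
      have h := norm_le_pow_iff_norm_lt_pow_add_one x 0
      simp only [zpow_zero, zero_add, zpow_one] at h
      simp only [Set.mem_ofPred_eq, Set.mem_sdiff, h, not_lt, zpow_one]
      exact le_antisymm_iff
    have hball : ∫ x in {x : ℚ_[p] | ‖x‖ ≤ p}, ψ (-x) ∂μ = 0 := by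
      refine setIntegral_eq_zero_of_add_right_eq_mul (measurableSet_norm_le _) (y := -y) hψy
        (fun x ↦ ⟨fun hx ↦ ?_, fun hx ↦ ?_⟩) fun x _ ↦ hψsub x
      · have := (nonarchimedean (x + -y) y).trans (max_le hx hy)
        rwa [neg_add_cancel_right] at this
      · exact (nonarchimedean x (-y)).trans (max_le hx (by rwa [norm_neg]))
    have hone : ∫ x in {x : ℚ_[p] | ‖x‖ ≤ 1}, ψ (-x) ∂μ = 1 := by
      rw [setIntegral_congr_fun (g := fun _ ↦ (1 : ℂ)) (measurableSet_norm_le _)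
        fun x (hx : ‖x‖ ≤ 1) ↦ hψtriv _ (by rwa [norm_neg]), setIntegral_const]
      simp [measureReal_def, hμ]
    have hψint : IntegrableOn (fun x ↦ ψ (-x)) {x : ℚ_[p] | ‖x‖ ≤ p} μ :=
      Measure.integrableOn_of_bounded (M := 1) (measure_norm_le_ne_top μ _)
        (hψcont.comp continuous_neg).measurable.aestronglyMeasurable
        (ae_of_all _ fun x ↦ (hψnorm (-x)).le)
    rw [setIntegral_congr_fun (g := fun x ↦ ((p : ℂ) ^ 2)⁻¹ * ψ (-x)) (measurableSet_norm_eq _)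
      fun x (hx : ‖x‖ = _) ↦ by simp [hx], integral_const_mul, hset,
      setIntegral_sdiff (measurableSet_norm_le _) hψint fun x (hx : ‖x‖ ≤ 1) ↦ hx.trans h1.le,
      hball, hone]
    ring
  have hsucc (m : ℤ) : ∫ x in {x : ℚ_[p] | (p : ℝ) ^ (-(m + 1)) ≤ ‖x‖},
      ((‖x‖⁻¹ ^ 2 : ℝ) : ℂ) * ψ (-x) ∂μ =
      ∫ x in {x : ℚ_[p] | (p : ℝ) ^ (-m) ≤ ‖x‖}, ((‖x‖⁻¹ ^ 2 : ℝ) : ℂ) * ψ (-x) ∂μ +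
      ∫ x in {x : ℚ_[p] | ‖x‖ = (p : ℝ) ^ (-(m + 1))}, ((‖x‖⁻¹ ^ 2 : ℝ) : ℂ) * ψ (-x) ∂μ := by
    have h := hint (m + 1)
    rw [setOf_zpow_le_norm_eq_union] at h ⊢
    exact setIntegral_union (disjoint_setOf_zpow_le_norm m) (measurableSet_norm_eq _)
      h.left_of_union h.right_of_union
  refine ⟨hint n, fun hn ↦ ?_, hzero n⟩
  induction n, hn using Int.leInduction with
  | base =>
    have h := hsucc (-2)
    rw [hzero _ le_rfl, show -((-2 : ℤ) + 1) = 1 by norm_num, hsphere_one] at h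
    rw [neg_neg, h, zpow_neg_one]
    ring
  | succ m hm ih =>
    rw [hsucc, ih, hsphere _ (by omega), neg_neg, add_sub_cancel_right]
    ring
end

section
/- For every a ∈ ℚ_pˣ, writing −a·U₁ = {−a(1 + z) : z ∈ pℤ_p} with U₁ = 1 + pℤ_p, one has ∫_{−a·U₁} |x|^{−2} ψ(−x) dx = |a|^{−1} ψ(a) q^{−1} when v(a) ≥ −1, and = 0 when v(a) ≤ −2. -/
open MeasureTheory

/-- A closed ball of radius `p ^ (n + 1)` around `0` in `ℚ_[p]` is the union of `p` closed balls
of radius `p ^ n`. -/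
theorem Padic.closedBall_zpow_succ {p : ℕ} [hp : Fact p.Prime] (n : ℤ) :
    Metric.closedBall (0 : ℚ_[p]) ((p : ℝ) ^ (n + 1)) =
      ⋃ i : Fin p, Metric.closedBall ((i : ℕ) * (p : ℚ_[p]) ^ (-(n + 1))) ((p : ℝ) ^ n) := by
  have hp0 : (0 : ℝ) < p := by exact_mod_cast hp.out.pos
  have hq0 : (p : ℚ_[p]) ≠ 0 := by exact_mod_cast hp.out.ne_zero
  ext x
  simp only [Set.mem_iUnion, Metric.mem_closedBall, dist_eq_norm, sub_zero]
  constructor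
  · intro hx
    have hy : ‖x * (p : ℚ_[p]) ^ (n + 1)‖ ≤ 1 := by
      rw [norm_mul, Padic.norm_p_zpow, zpow_neg]
      rw [← div_eq_mul_inv]
      exact div_le_one_of_le₀ hx (by positivity)
    obtain ⟨y, hyx⟩ : ∃ y : ℤ_[p], (y : ℚ_[p]) = x * (p : ℚ_[p]) ^ (n + 1) := ⟨⟨_, hy⟩, rfl⟩
    obtain ⟨i, hi, hm⟩ := PadicInt.exists_mem_range y
    refine ⟨⟨i, hi⟩, ?_⟩
    have h1 : ‖x * (p : ℚ_[p]) ^ (n + 1) - i‖ ≤ (p : ℝ) ^ (-1 : ℤ) := by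
      rw [PadicInt.maximalIdeal_eq_span_p] at hm
      have := (PadicInt.norm_le_pow_iff_mem_span_pow _ 1).2 (by simpa using hm)
      rw [PadicInt.norm_def, PadicInt.coe_sub, PadicInt.coe_natCast, hyx] at this
      exact_mod_cast this
    have h2 : x - i * (p : ℚ_[p]) ^ (-(n + 1)) =
        (x * (p : ℚ_[p]) ^ (n + 1) - i) * (p : ℚ_[p]) ^ (-(n + 1)) := by
      rw [sub_mul, mul_assoc, ← zpow_add₀ hq0]
      simp
    rw [h2, norm_mul, Padic.norm_p_zpow, neg_neg]
    calc _ ≤ (p : ℝ) ^ (-1 : ℤ) * (p : ℝ) ^ (n + 1) := by gcongr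
      _ = _ := by rw [← zpow_add₀ hp0.ne']; congr 1; ring
  · rintro ⟨i, hi⟩
    have hle : (p : ℝ) ^ n ≤ (p : ℝ) ^ (n + 1) :=
      zpow_le_zpow_right₀ (by exact_mod_cast hp.out.one_le) (by lia)
    have h3 : ‖((i : ℕ) : ℚ_[p]) * (p : ℚ_[p]) ^ (-(n + 1))‖ ≤ (p : ℝ) ^ (n + 1) := by
      rw [norm_mul, Padic.norm_p_zpow, neg_neg]
      exact mul_le_of_le_one_left (by positivity) (by exact_mod_cast Padic.norm_int_le_one (i : ℤ))
    have := Padic.nonarchimedean (x - ((i : ℕ) : ℚ_[p]) * (p : ℚ_[p]) ^ (-(n + 1)))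
      (((i : ℕ) : ℚ_[p]) * (p : ℚ_[p]) ^ (-(n + 1)))
    rw [sub_add_cancel] at this
    exact this.trans (max_le (hi.trans hle) h3)

theorem Padic.pairwise_disjoint_closedBall_mul_zpow {p : ℕ} [hp : Fact p.Prime] (n : ℤ) :
    Pairwise (Function.onFun Disjoint fun i : Fin p =>
      Metric.closedBall ((i : ℕ) * (p : ℚ_[p]) ^ (-(n + 1))) ((p : ℝ) ^ n)) := by
  have hp0 : (0 : ℝ) < p := by exact_mod_cast hp.out.pos
  have hp1 : (1 : ℝ) < p := by exact_mod_cast hp.out.one_lt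
  intro i j hij
  refine Set.disjoint_left.2 fun x hi hj => hij ?_
  rw [Metric.mem_closedBall, dist_eq_norm] at hi hj
  have h1 : ‖(((i : ℕ) - (j : ℕ) : ℤ) : ℚ_[p]) * (p : ℚ_[p]) ^ (-(n + 1))‖ ≤ (p : ℝ) ^ n := by
    have h := Padic.nonarchimedean (x - ((j : ℕ) : ℚ_[p]) * (p : ℚ_[p]) ^ (-(n + 1)))
      (-(x - ((i : ℕ) : ℚ_[p]) * (p : ℚ_[p]) ^ (-(n + 1))))
    rw [norm_neg] at h
    refine le_trans (le_of_eq ?_) (h.trans (max_le hj hi))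
    congr 1
    push_cast
    ring
  have h2 : ‖(((i : ℕ) - (j : ℕ) : ℤ) : ℚ_[p])‖ < 1 := by
    rw [norm_mul, Padic.norm_p_zpow, neg_neg] at h1
    have hlt : (p : ℝ) ^ n < (p : ℝ) ^ (n + 1) := zpow_lt_zpow_right₀ hp1 (by lia)
    by_contra! hge
    have := le_mul_of_one_le_left (zpow_pos hp0 (n + 1)).le hge
    linarith
  rw [Padic.norm_intCast_lt_one_iff] at h2
  have h3 : ((j : ℕ) : ℤ) ≡ (i : ℕ) [ZMOD p] := (Int.modEq_iff_dvd).2 h2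
  have h5 := (Int.natCast_modEq_iff.1 h3)
  exact Fin.ext (Nat.ModEq.eq_of_lt_of_lt h5 j.2 i.2).symm

theorem Padic.measure_closedBall_center {p : ℕ} [Fact p.Prime] [MeasurableSpace ℚ_[p]]
    [BorelSpace ℚ_[p]] (μ : Measure ℚ_[p]) [μ.IsAddHaarMeasure] (c : ℚ_[p]) (r : ℝ) :
    μ (Metric.closedBall c r) = μ (Metric.closedBall 0 r) := by
  rw [← measure_preimage_add μ c (Metric.closedBall c r)]
  simp

theorem Padic.measure_closedBall_zpow {p : ℕ} [hp : Fact p.Prime] [MeasurableSpace ℚ_[p]]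
    [BorelSpace ℚ_[p]] (μ : Measure ℚ_[p]) [μ.IsAddHaarMeasure]
    (hμ : μ (Metric.closedBall 0 1) = 1) (c : ℚ_[p]) (n : ℤ) :
    μ.real (Metric.closedBall c ((p : ℝ) ^ n)) = (p : ℝ) ^ n := by
  have hp0 : (p : ℝ) ≠ 0 := by exact_mod_cast hp.out.ne_zero
  have hstep (n : ℤ) : μ.real (Metric.closedBall 0 ((p : ℝ) ^ (n + 1))) =
      p * μ.real (Metric.closedBall 0 ((p : ℝ) ^ n)) := by
    rw [Measure.real, Padic.closedBall_zpow_succ,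
      measure_iUnion (Padic.pairwise_disjoint_closedBall_mul_zpow n)
        fun _ => Metric.isClosed_closedBall.measurableSet]
    simp [Padic.measure_closedBall_center μ _ ((p : ℝ) ^ n), Measure.real]
  rw [Measure.real, Padic.measure_closedBall_center, ← Measure.real]
  induction n using Int.induction_on with
  | zero => simp [Measure.real, hμ]
  | succ k ih => rw [hstep, ih, zpow_add_one₀ hp0, mul_comm]
  | pred k ih =>
    have h := hstep (-k - 1)
    rw [sub_add_cancel, ih] at h
    refine mul_left_cancel₀ hp0 ?_
    rw [← h, ← zpow_one_add₀ hp0]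
    congr 1
    ring

theorem Padic.image_neg_mul_one_add {p : ℕ} [Fact p.Prime] {a : ℚ_[p]} (ha : a ≠ 0) (r : ℝ) :
    (fun z : ℚ_[p] => -a * (1 + z)) '' {z : ℚ_[p] | ‖z‖ ≤ r} =
      Metric.closedBall (-a) (‖a‖ * r) := by
  ext x
  simp only [Set.mem_image, Set.mem_ofPred_eq, Metric.mem_closedBall, dist_eq_norm]
  constructor
  · rintro ⟨z, hz, rfl⟩
    rw [show -a * (1 + z) - -a = -(a * z) by ring, norm_neg, norm_mul]
    gcongr
  · intro hx
    refine ⟨-(x - -a) / a, ?_, by field_simp; ring⟩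
    rw [norm_div, norm_neg, div_le_iff₀ (norm_pos_iff.2 ha), mul_comm]
    exact hx

/-- The integral of a function over a ball vanishes if translation by some element, of norm at
most the radius, multiplies the function by a constant different from `1`. -/
theorem Padic.setIntegral_closedBall_eq_zero {p : ℕ} [Fact p.Prime] [MeasurableSpace ℚ_[p]]
    [BorelSpace ℚ_[p]] (μ : Measure ℚ_[p]) [μ.IsAddHaarMeasure] {f : ℚ_[p] → ℂ} {t : ℚ_[p]}
    {w : ℂ} (hw : w ≠ 1) (hf : ∀ x, f (x + t) = w * f x) {r : ℝ} (ht : ‖t‖ ≤ r) (c : ℚ_[p]) :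
    ∫ x in Metric.closedBall c r, f x ∂μ = 0 := by
  have hmem (x : ℚ_[p]) : x + t ∈ Metric.closedBall c r ↔ x ∈ Metric.closedBall c r := by
    simp only [Metric.mem_closedBall, dist_eq_norm]
    constructor <;> intro h
    · have := Padic.nonarchimedean (x + t - c) (-t)
      rw [norm_neg, show x + t - c + -t = x - c by ring] at this
      exact this.trans (max_le h ht)
    · have := Padic.nonarchimedean (x - c) t
      rw [show x - c + t = x + t - c by ring] at this
      exact this.trans (max_le h ht)
  have key : ∫ x in Metric.closedBall c r, f x ∂μ =
      w * ∫ x in Metric.closedBall c r, f x ∂μ := by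
    rw [← integral_indicator Metric.isClosed_closedBall.measurableSet, ← integral_const_mul]
    conv_lhs => rw [← integral_add_right_eq_self _ t]
    congr 1 with x
    by_cases hx : x ∈ Metric.closedBall c r
    · rw [Set.indicator_of_mem ((hmem x).2 hx), Set.indicator_of_mem hx, hf]
    · rw [Set.indicator_of_notMem (mt (hmem x).1 hx), Set.indicator_of_notMem hx, mul_zero]
  have : (1 - w) * ∫ x in Metric.closedBall c r, f x ∂μ = 0 := by linear_combination key
  exact (mul_eq_zero.1 this).resolve_left (sub_ne_zero.2 hw.symm)

/-- For every `a ∈ ℚ_pˣ`, writing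
`−a·U₁ = {−a(1+z) : z ∈ pℤ_p}` (`U₁ = 1 + pℤ_p`), one has
`∫_{−a·U₁} |x|^{−2} ψ(−x) dx = |a|^{−1} ψ(a) q^{−1}` when `v(a) ≥ −1`, and
`= 0` when `v(a) ≤ −2`. -/
theorem integral_inv_norm_sq_addChar_on_coset
    {p : ℕ} [Fact p.Prime] [MeasurableSpace ℚ_[p]] [BorelSpace ℚ_[p]]
    (μ : Measure ℚ_[p]) [μ.IsAddHaarMeasure]
    (hμ : μ {x : ℚ_[p] | ‖x‖ ≤ 1} = 1)
    -- ψ : an unramified continuous additive character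
    (ψ : ℚ_[p] → ℂ)
    (hψadd : ∀ x y : ℚ_[p], ψ (x + y) = ψ x * ψ y)
    (hψcont : Continuous ψ)
    (hψtriv : ∀ x : ℚ_[p], ‖x‖ ≤ 1 → ψ x = 1)
    (hψntriv : ∃ x : ℚ_[p], ‖x‖ ≤ p ∧ ψ x ≠ 1)
    (a : ℚ_[p]) (ha : a ≠ 0) :
    (-1 ≤ a.valuation →
      ∫ x in (fun z : ℚ_[p] => -a * (1 + z)) '' {z : ℚ_[p] | ‖z‖ ≤ (p : ℝ)⁻¹},
          ((‖x‖⁻¹ ^ 2 : ℝ) : ℂ) * ψ (-x) ∂μ =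
        ((‖a‖⁻¹ : ℝ) : ℂ) * ψ a * (p : ℂ)⁻¹) ∧
    (a.valuation ≤ -2 →
      ∫ x in (fun z : ℚ_[p] => -a * (1 + z)) '' {z : ℚ_[p] | ‖z‖ ≤ (p : ℝ)⁻¹},
          ((‖x‖⁻¹ ^ 2 : ℝ) : ℂ) * ψ (-x) ∂μ = 0) := by
  have hp : p.Prime := Fact.out
  have hp1 : (1 : ℝ) < p := by exact_mod_cast hp.one_lt
  have hp0 : (0 : ℝ) < p := by linarith
  have ha0 : 0 < ‖a‖ := norm_pos_iff.2 ha
  have hnorm : ‖a‖ * (p : ℝ)⁻¹ = (p : ℝ) ^ (-a.valuation - 1) := by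
    rw [Padic.norm_eq_zpow_neg_valuation ha, zpow_sub_one₀ hp0.ne']
  have hμ' : μ (Metric.closedBall 0 1) = 1 := by
    rw [← hμ]; congr 1; ext x; simp
  have hx (x : ℚ_[p]) (h : x ∈ Metric.closedBall (-a) (‖a‖ * (p : ℝ)⁻¹)) : ‖x‖ = ‖a‖ := by
    rw [Metric.mem_closedBall, dist_eq_norm] at h
    have hlt : ‖x - -a‖ < ‖-a‖ := by
      rw [norm_neg]
      exact h.trans_lt (mul_lt_of_lt_one_right ha0 (inv_lt_one_of_one_lt₀ hp1))
    have := Padic.add_eq_max_of_ne hlt.ne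
    rw [sub_add_cancel, max_eq_right hlt.le, norm_neg] at this
    exact this
  have hmeas : MeasurableSet (Metric.closedBall (-a) (‖a‖ * (p : ℝ)⁻¹)) :=
    Metric.isClosed_closedBall.measurableSet
  rw [Padic.image_neg_mul_one_add ha]
  constructor
  · intro hv
    have hle : ‖a‖ * (p : ℝ)⁻¹ ≤ 1 := by
      rw [hnorm]
      exact zpow_le_one_of_nonpos₀ hp1.le (by lia)
    rw [setIntegral_congr_fun (g := fun _ => ((‖a‖⁻¹ ^ 2 : ℝ) : ℂ) * ψ a) hmeas]
    · rw [setIntegral_const, hnorm, Padic.measure_closedBall_zpow μ hμ', ← hnorm,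
        Complex.real_smul]
      have : (‖a‖ : ℂ) ≠ 0 := by exact_mod_cast ha0.ne'
      push_cast
      field_simp
    · intro x h
      have h1 : ψ (-x) = ψ a := by
        rw [show -x = a + -(x - -a) by ring, hψadd, hψtriv (-(x - -a)), mul_one]
        rw [Metric.mem_closedBall, dist_eq_norm] at h
        rw [norm_neg]
        exact h.trans hle
      simp only [hx x h, h1]
  · intro hv
    obtain ⟨t, ht, hψt⟩ := hψntriv
    have hle : ‖-t‖ ≤ ‖a‖ * (p : ℝ)⁻¹ := by
      rw [norm_neg, hnorm]
      refine ht.trans ?_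
      simpa using zpow_le_zpow_right₀ hp1.le (show (1 : ℤ) ≤ -a.valuation - 1 by lia)
    rw [setIntegral_congr_fun (g := fun x => ((‖a‖⁻¹ ^ 2 : ℝ) : ℂ) * ψ (-x)) hmeas
      fun x h => by simp only [hx x h]]
    refine Padic.setIntegral_closedBall_eq_zero μ hψt (fun x => ?_) hle (-a)
    rw [neg_add, neg_neg, hψadd]
    ring
end

section
/- For every a ∈ ℚ_pˣ, let S_a := {x ∈ ℚ_pˣ : v(x) ≤ v(a)} \ (−a·U₁), where −a·U₁ = {−a(1+z) : z ∈ pℤ_p}. Then the function x ↦ |x|^{−2} ψ(−x) is integrable on S_a, and ∫_{S_a} |x|^{−2} ψ(−x) dx = |a|^{−1} (1 − ψ(a) q^{−1}) − q^{−1}(1 + q^{−1}) when v(a) ≥ −1, and = 0 when v(a) ≤ −2. -/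
open MeasureTheory Metric

section PadicBalls

variable {p : ℕ} [hp : Fact p.Prime]

lemma Padic.exists_norm_eq_zpow {x : ℚ_[p]} (hx : x ≠ 0) : ∃ k : ℤ, ‖x‖ = (p : ℝ) ^ k :=
  ⟨_, Padic.norm_eq_zpow_neg_valuation hx⟩

lemma Padic.norm_add_eq_of_lt {x y : ℚ_[p]} (h : ‖y‖ < ‖x‖) : ‖x + y‖ = ‖x‖ := by
  rw [IsUltrametricDist.norm_add_eq_max_of_norm_ne_norm h.ne', max_eq_left h.le]

lemma Padic.norm_add_le_iff_of_le {x y : ℚ_[p]} {r : ℝ} (h : ‖y‖ ≤ r) :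
    ‖x + y‖ ≤ r ↔ ‖x‖ ≤ r := by
  constructor
  · intro hxy
    have := IsUltrametricDist.norm_add_le_max (x + y) (-y)
    rw [add_neg_cancel_right, norm_neg] at this
    exact this.trans (max_le hxy h)
  · intro hx
    exact (IsUltrametricDist.norm_add_le_max x y).trans (max_le hx h)

lemma Padic.zpow_le_norm_add_iff {x y : ℚ_[p]} {r : ℝ} (h : ‖y‖ < r) :
    r ≤ ‖x + y‖ ↔ r ≤ ‖x‖ := by
  constructor
  · intro hxy
    have := Padic.norm_add_eq_of_lt (x := x + y) (y := -y) (by rw [norm_neg]; linarith)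
    rw [add_neg_cancel_right] at this
    rwa [this]
  · intro hx
    rwa [Padic.norm_add_eq_of_lt (h.trans_le hx)]

/-- A closed ball of radius `p ^ (k + 1)` is a union of `p` closed balls of radius `p ^ k`. -/
lemma Padic.closedBall_zero_zpow_succ (k : ℤ) :
    closedBall (0 : ℚ_[p]) ((p : ℝ) ^ (k + 1)) =
      ⋃ i ∈ Finset.range p, closedBall ((i : ℚ_[p]) * (p : ℚ_[p]) ^ (-(k + 1))) ((p : ℝ) ^ k) := by
  have hp0 : (0 : ℝ) < p := by exact_mod_cast hp.out.pos
  have hpQ : (p : ℚ_[p]) ≠ 0 := by exact_mod_cast hp.out.ne_zero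
  have hp1 : (1 : ℝ) ≤ p := by exact_mod_cast hp.out.one_le
  ext x
  simp only [mem_closedBall, dist_eq_norm, sub_zero, Set.mem_iUnion, Finset.mem_range,
    exists_prop]
  constructor
  · intro hx
    have hy : ‖x * (p : ℚ_[p]) ^ (k + 1)‖ ≤ 1 := by
      rw [norm_mul, Padic.norm_p_zpow, zpow_neg, ← div_eq_mul_inv]
      exact (div_le_one (by positivity)).2 hx
    obtain ⟨n, hn, hmem⟩ := PadicInt.exists_mem_range (⟨x * (p : ℚ_[p]) ^ (k + 1), hy⟩ : ℤ_[p])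
    refine ⟨n, hn, ?_⟩
    have h1 := PadicInt.mem_nonunits.1 ((IsLocalRing.mem_maximalIdeal _).1 hmem)
    rw [PadicInt.norm_def] at h1
    have h2 : x - n * (p : ℚ_[p]) ^ (-(k + 1)) =
        (x * (p : ℚ_[p]) ^ (k + 1) - n) * (p : ℚ_[p]) ^ (-(k + 1)) := by
      rw [sub_mul, mul_assoc, ← zpow_add₀ hpQ]; simp
    rw [Padic.norm_le_pow_iff_norm_lt_pow_add_one, h2, norm_mul, Padic.norm_p_zpow, neg_neg]
    exact mul_lt_of_lt_one_left (by positivity) h1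
  · rintro ⟨i, -, hx⟩
    refine (Padic.norm_add_le_iff_of_le (y := -((i : ℚ_[p]) * (p : ℚ_[p]) ^ (-(k + 1)))) ?_).1 ?_
    · rw [norm_neg, norm_mul, Padic.norm_p_zpow, neg_neg]
      exact mul_le_of_le_one_left (by positivity) (by simpa using Padic.norm_int_le_one (p := p) (i : ℤ))
    · rw [← sub_eq_add_neg]
      exact hx.trans (zpow_le_zpow_right₀ hp1 (by lia))

lemma Padic.pairwiseDisjoint_closedBall (k : ℤ) :
    (Finset.range p : Set ℕ).PairwiseDisjoint
      fun i => closedBall ((i : ℚ_[p]) * (p : ℚ_[p]) ^ (-(k + 1))) ((p : ℝ) ^ k) := by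
  have hp0 : (0 : ℝ) < p := by exact_mod_cast hp.out.pos
  intro i hi j hj hij
  simp only [Finset.coe_range, Set.mem_Iio] at hi hj
  refine Set.disjoint_left.2 fun x hxi hxj => ?_
  rw [mem_closedBall, dist_eq_norm] at hxi hxj
  rw [← norm_neg] at hxj
  have h := (IsUltrametricDist.norm_add_le_max _ _).trans (max_le hxi hxj)
  rw [← sub_eq_add_neg, sub_sub_sub_cancel_left, ← sub_mul, norm_mul, Padic.norm_p_zpow, neg_neg,
    zpow_add₀ hp0.ne', zpow_one, mul_comm, mul_assoc] at h
  have h1 : (p : ℝ) * ‖((j - i : ℤ) : ℚ_[p])‖ ≤ 1 := by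
    push_cast
    exact le_of_mul_le_mul_left (by simpa using h) (zpow_pos hp0 k)
  have h2 : ‖((j - i : ℤ) : ℚ_[p])‖ < 1 := by
    have : (1 : ℝ) < p := by exact_mod_cast hp.out.one_lt
    nlinarith [norm_nonneg ((j - i : ℤ) : ℚ_[p])]
  rw [Padic.norm_intCast_lt_one_iff] at h2
  obtain ⟨c, hc⟩ := h2
  have : |c| < 1 := by
    by_contra! hc1
    have : (p : ℤ) ≤ |(j : ℤ) - i| := by
      rw [hc, abs_mul, Nat.abs_cast]
      nlinarith [hp.out.pos]
    rw [le_abs] at this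
    lia
  rw [Int.abs_lt_one_iff] at this
  subst this
  lia

lemma Padic.sphere_zpow_eq (k : ℤ) :
    sphere (0 : ℚ_[p]) ((p : ℝ) ^ k) =
      closedBall 0 ((p : ℝ) ^ k) \ closedBall 0 ((p : ℝ) ^ (k - 1)) := by
  ext x
  have := Padic.norm_le_pow_iff_norm_lt_pow_add_one x (k - 1)
  rw [sub_add_cancel] at this
  simp only [mem_sphere, dist_zero_right, Set.mem_sdiff, mem_closedBall, this, not_lt]
  exact le_antisymm_iff

lemma Padic.closedBall_zpow_sub_one_subset (k : ℤ) :
    closedBall (0 : ℚ_[p]) ((p : ℝ) ^ (k - 1)) ⊆ closedBall 0 ((p : ℝ) ^ k) :=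
  closedBall_subset_closedBall
    (zpow_le_zpow_right₀ (by exact_mod_cast hp.out.one_le) (by lia))

/-- The exterior of an open ball is the disjoint union of a sphere and a smaller exterior. -/
lemma Padic.setOf_zpow_le_norm_eq_union_s12 (k : ℤ) :
    {x : ℚ_[p] | (p : ℝ) ^ k ≤ ‖x‖} =
      {x : ℚ_[p] | (p : ℝ) ^ (k + 1) ≤ ‖x‖} ∪ sphere 0 ((p : ℝ) ^ k) := by
  ext x
  have := Padic.norm_le_pow_iff_norm_lt_pow_add_one x k
  simp only [Set.mem_ofPred_eq, Set.mem_union, mem_sphere, dist_zero_right]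
  rw [← not_lt (a := ‖x‖) (b := (p : ℝ) ^ (k + 1)), ← this, not_le, le_iff_lt_or_eq, eq_comm]

lemma Padic.setOf_zpow_le_norm_eq_iUnion_s12 (k : ℤ) :
    {x : ℚ_[p] | (p : ℝ) ^ k ≤ ‖x‖} = ⋃ j : ℕ, sphere 0 ((p : ℝ) ^ (k + j)) := by
  have hp1 : (1 : ℝ) < p := by exact_mod_cast hp.out.one_lt
  ext x
  simp only [Set.mem_ofPred_eq, Set.mem_iUnion, mem_sphere, dist_zero_right]
  constructor
  · intro h
    have hx : x ≠ 0 := norm_pos_iff.1 (lt_of_lt_of_le (zpow_pos (by linarith) k) h)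
    obtain ⟨l, hl⟩ := Padic.exists_norm_eq_zpow hx
    rw [hl, zpow_le_zpow_iff_right₀ hp1] at h
    exact ⟨(l - k).toNat, by rw [hl]; congr 1; lia⟩
  · rintro ⟨j, hj⟩
    rw [hj, zpow_le_zpow_iff_right₀ hp1]
    lia

variable [MeasurableSpace ℚ_[p]] [BorelSpace ℚ_[p]] (μ : Measure ℚ_[p]) [μ.IsAddHaarMeasure]

lemma Padic.measureReal_closedBall_eq (c : ℚ_[p]) (r : ℝ) :
    μ.real (closedBall c r) = μ.real (closedBall 0 r) := by
  rw [← add_zero c, ← vadd_eq_add, ← vadd_closedBall, measureReal_def, measure_vadd,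
    measureReal_def]

lemma Padic.measureReal_closedBall_zpow_succ (k : ℤ) :
    μ.real (closedBall (0 : ℚ_[p]) ((p : ℝ) ^ (k + 1))) =
      p * μ.real (closedBall (0 : ℚ_[p]) ((p : ℝ) ^ k)) := by
  rw [Padic.closedBall_zero_zpow_succ, measureReal_biUnion_finset
    (Padic.pairwiseDisjoint_closedBall k) (fun _ _ => measurableSet_closedBall)
    (fun _ _ => measure_closedBall_lt_top.ne)]
  simp [Padic.measureReal_closedBall_eq μ (_ * _)]

/-- If the ring of integers has volume one, then a ball of radius `p ^ k` has volume `p ^ k`. -/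
lemma Padic.measureReal_closedBall_zpow (hμ : μ {x : ℚ_[p] | ‖x‖ ≤ 1} = 1) (c : ℚ_[p]) (k : ℤ) :
    μ.real (closedBall c ((p : ℝ) ^ k)) = (p : ℝ) ^ k := by
  have hp0 : (p : ℝ) ≠ 0 := by exact_mod_cast hp.out.ne_zero
  rw [Padic.measureReal_closedBall_eq]
  induction k using Int.induction_on with
  | zero =>
    have : closedBall (0 : ℚ_[p]) 1 = {x | ‖x‖ ≤ 1} := by ext; simp
    simp [measureReal_def, this, hμ]
  | succ k ih => rw [Padic.measureReal_closedBall_zpow_succ, ih, zpow_add_one₀ hp0, mul_comm]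
  | pred k ih =>
    have h := Padic.measureReal_closedBall_zpow_succ μ (-(k : ℤ) - 1)
    rw [sub_add_cancel, ih] at h
    refine mul_left_cancel₀ hp0 ?_
    rw [← h, ← zpow_one_add₀ hp0, add_sub_cancel]

end PadicBalls

/-- A function that gets multiplied by a constant `c ≠ 1` under a translation has integral zero. -/
lemma integral_eq_zero_of_add_right_eq_mul {G : Type*} [AddGroup G] [MeasurableSpace G]
    [MeasurableAdd G] {μ : Measure G} [μ.IsAddRightInvariant] {f : G → ℂ} {t : G} {c : ℂ}
    (hc : c ≠ 1) (hf : ∀ x, f (x + t) = c * f x) : ∫ x, f x ∂μ = 0 := by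
  have h := integral_add_right_eq_self (μ := μ) f t
  simp_rw [hf, integral_const_mul] at h
  have : (c - 1) * ∫ x, f x ∂μ = 0 := by rw [sub_mul, h]; ring
  exact (mul_eq_zero.1 this).resolve_left (sub_ne_zero.2 hc)

/-- A function that gets multiplied by a constant `c ≠ 1` under a translation has integral zero on
every set stable under that translation. -/
lemma setIntegral_eq_zero_of_add_right_eq_mul {G : Type*} [AddGroup G] [MeasurableSpace G]
    [MeasurableAdd G] {μ : Measure G} [μ.IsAddRightInvariant] {f : G → ℂ} {s : Set G}
    (hs : MeasurableSet s) {t : G} {c : ℂ} (hc : c ≠ 1) (hst : ∀ x, x + t ∈ s ↔ x ∈ s)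
    (hf : ∀ x ∈ s, f (x + t) = c * f x) : ∫ x in s, f x ∂μ = 0 := by
  rw [← integral_indicator hs]
  refine integral_eq_zero_of_add_right_eq_mul hc (t := t) fun x => ?_
  by_cases hx : x ∈ s
  · simp [hx, hst, hf x hx]
  · simp [hx, hst]

section UnramifiedCharacter

variable {p : ℕ} [hp : Fact p.Prime] {ψ : ℚ_[p] → ℂ}

lemma Padic.norm_unramified_eq_one (hadd : ∀ x y : ℚ_[p], ψ (x + y) = ψ x * ψ y)
    (htriv : ∀ x : ℚ_[p], ‖x‖ ≤ 1 → ψ x = 1) (x : ℚ_[p]) : ‖ψ x‖ = 1 := by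
  have hp1 : (1 : ℝ) < p := by exact_mod_cast hp.out.one_lt
  have hnsmul : ∀ n : ℕ, ψ (n * x) = ψ x ^ n := by
    intro n
    induction n with
    | zero => simpa using htriv 0 (by simp)
    | succ n ih => rw [Nat.cast_succ, add_mul, one_mul, hadd, ih, pow_succ]
  obtain ⟨m, hm⟩ := pow_unbounded_of_one_lt ‖x‖ hp1
  have h : ψ x ^ (p ^ m) = 1 := by
    rw [← hnsmul]
    refine htriv _ ?_
    rw [Nat.cast_pow, norm_mul, norm_pow, Padic.norm_p, inv_pow, inv_mul_eq_div]
    exact (div_le_one (by positivity)).2 hm.le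
  exact Complex.norm_eq_one_of_pow_eq_one h (pow_ne_zero m hp.out.ne_zero)

variable [MeasurableSpace ℚ_[p]] [BorelSpace ℚ_[p]] {μ : Measure ℚ_[p]} [μ.IsAddHaarMeasure]

lemma Padic.integrableOn_inv_norm_sq_mul_unramified (hμ : μ {x : ℚ_[p] | ‖x‖ ≤ 1} = 1)
    (hadd : ∀ x y : ℚ_[p], ψ (x + y) = ψ x * ψ y) (hcont : Continuous ψ)
    (htriv : ∀ x : ℚ_[p], ‖x‖ ≤ 1 → ψ x = 1) (k : ℤ) :
    IntegrableOn (fun x : ℚ_[p] => ((‖x‖⁻¹ ^ 2 : ℝ) : ℂ) * ψ (-x))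
      {x : ℚ_[p] | (p : ℝ) ^ k ≤ ‖x‖} μ := by
  have hp1 : (1 : ℝ) < p := by exact_mod_cast hp.out.one_lt
  have hp0 : (0 : ℝ) < p := by linarith
  have hnorm : ∀ l : ℤ, ∀ x ∈ sphere (0 : ℚ_[p]) ((p : ℝ) ^ l),
      ‖((‖x‖⁻¹ ^ 2 : ℝ) : ℂ) * ψ (-x)‖ = ((p : ℝ) ^ l)⁻¹ ^ 2 := by
    intro l x hx
    rw [mem_sphere_zero_iff_norm] at hx
    rw [norm_mul, Padic.norm_unramified_eq_one hadd htriv, mul_one, Complex.norm_real, hx,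
      Real.norm_of_nonneg (by positivity)]
  have hmeas : ∀ l : ℤ, μ.real (sphere (0 : ℚ_[p]) ((p : ℝ) ^ l)) ≤ (p : ℝ) ^ l := fun l =>
    (measureReal_mono sphere_subset_closedBall measure_closedBall_lt_top.ne).trans_eq
      (Padic.measureReal_closedBall_zpow μ hμ 0 l)
  rw [Padic.setOf_zpow_le_norm_eq_iUnion_s12]
  refine integrableOn_iUnion_of_summable_integral_norm (fun j => ?_) ?_
  · refine Measure.integrableOn_of_bounded (M := ((p : ℝ) ^ (k + j))⁻¹ ^ 2)
      ((measure_mono sphere_subset_closedBall).trans_lt measure_closedBall_lt_top).ne ?_ ?_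
    · have : Measurable ψ := hcont.measurable
      exact Measurable.aestronglyMeasurable (by fun_prop)
    · exact (ae_restrict_mem isClosed_sphere.measurableSet).mono
        fun x hx => (hnorm _ x hx).le
  · refine Summable.of_nonneg_of_le (fun j => integral_nonneg fun _ => norm_nonneg _)
      (fun j => ?_) ((summable_geometric_of_lt_one (inv_nonneg.2 hp0.le)
        (inv_lt_one_of_one_lt₀ hp1)).mul_left (((p : ℝ) ^ k)⁻¹))
    rw [setIntegral_congr_fun isClosed_sphere.measurableSet (hnorm (k + j)), setIntegral_const,
      smul_eq_mul]
    calc _ ≤ (p : ℝ) ^ (k + j) * ((p : ℝ) ^ (k + j))⁻¹ ^ 2 := by gcongr; exact hmeas _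
      _ = _ := by
        rw [zpow_add₀ hp0.ne', zpow_natCast, inv_pow (p : ℝ) j]
        field_simp

/-- The integral of an unramified character over the sphere of radius `p ^ k`, `k ≤ 0`. -/
lemma Padic.setIntegral_sphere_unramified_of_nonpos (hμ : μ {x : ℚ_[p] | ‖x‖ ≤ 1} = 1)
    (htriv : ∀ x : ℚ_[p], ‖x‖ ≤ 1 → ψ x = 1) {k : ℤ} (hk : k ≤ 0) :
    ∫ x in sphere 0 ((p : ℝ) ^ k), ψ (-x) ∂μ = (p : ℂ) ^ k - (p : ℂ) ^ (k - 1) := by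
  have hp1 : (1 : ℝ) ≤ p := by exact_mod_cast hp.out.one_le
  rw [setIntegral_congr_fun (g := fun _ => (1 : ℂ)) isClosed_sphere.measurableSet,
    setIntegral_const, Padic.sphere_zpow_eq,
    measureReal_sdiff (Padic.closedBall_zpow_sub_one_subset k) measurableSet_closedBall
      measure_closedBall_lt_top.ne,
    Padic.measureReal_closedBall_zpow μ hμ, Padic.measureReal_closedBall_zpow μ hμ]
  · simp
  · intro x hx
    rw [mem_sphere_zero_iff_norm] at hx
    exact htriv _ (by rw [norm_neg, hx]; exact zpow_le_one_of_nonpos₀ hp1 hk)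

lemma Padic.setIntegral_sphere_unramified_one (hμ : μ {x : ℚ_[p] | ‖x‖ ≤ 1} = 1)
    (hadd : ∀ x y : ℚ_[p], ψ (x + y) = ψ x * ψ y) (hcont : Continuous ψ)
    (htriv : ∀ x : ℚ_[p], ‖x‖ ≤ 1 → ψ x = 1) {t : ℚ_[p]} (ht : ‖t‖ ≤ p) (hψt : ψ t ≠ 1) :
    ∫ x in sphere 0 ((p : ℝ) ^ (1 : ℤ)), ψ (-x) ∂μ = -1 := by
  have hint : IntegrableOn (fun x => ψ (-x)) (closedBall 0 ((p : ℝ) ^ (1 : ℤ))) μ :=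
    (hcont.comp continuous_neg).continuousOn.integrableOn_compact (isCompact_closedBall _ _)
  have hzero : ∫ x in closedBall 0 ((p : ℝ) ^ (1 : ℤ)), ψ (-x) ∂μ = 0 := by
    refine setIntegral_eq_zero_of_add_right_eq_mul measurableSet_closedBall (t := -t) hψt
      (fun x => ?_) (fun x _ => ?_)
    · simp only [mem_closedBall_zero_iff]
      exact Padic.norm_add_le_iff_of_le (by simpa using ht)
    · rw [neg_add, neg_neg, hadd, mul_comm]
  rw [Padic.sphere_zpow_eq, setIntegral_sdiff measurableSet_closedBall hint
    (Padic.closedBall_zpow_sub_one_subset 1), hzero,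
    setIntegral_congr_fun (g := fun _ => (1 : ℂ)) measurableSet_closedBall, setIntegral_const,
    Padic.measureReal_closedBall_zpow μ hμ]
  · simp
  · intro x hx
    exact htriv _ (by simpa using hx)

/-- Splitting off the innermost sphere from the domain of integration. -/
lemma Padic.setIntegral_exterior_eq_add (hμ : μ {x : ℚ_[p] | ‖x‖ ≤ 1} = 1)
    (hadd : ∀ x y : ℚ_[p], ψ (x + y) = ψ x * ψ y) (hcont : Continuous ψ)
    (htriv : ∀ x : ℚ_[p], ‖x‖ ≤ 1 → ψ x = 1) (k : ℤ) :
    ∫ x in {x : ℚ_[p] | (p : ℝ) ^ k ≤ ‖x‖}, ((‖x‖⁻¹ ^ 2 : ℝ) : ℂ) * ψ (-x) ∂μ =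
      ∫ x in {x : ℚ_[p] | (p : ℝ) ^ (k + 1) ≤ ‖x‖}, ((‖x‖⁻¹ ^ 2 : ℝ) : ℂ) * ψ (-x) ∂μ +
        ((p : ℂ) ^ k)⁻¹ ^ 2 * ∫ x in sphere 0 ((p : ℝ) ^ k), ψ (-x) ∂μ := by
  have hp1 : (1 : ℝ) < p := by exact_mod_cast hp.out.one_lt
  have hint := Padic.integrableOn_inv_norm_sq_mul_unramified hμ hadd hcont htriv k
  rw [Padic.setOf_zpow_le_norm_eq_union_s12] at hint ⊢
  rw [setIntegral_union _ isClosed_sphere.measurableSet hint.left_of_union hint.right_of_union,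
    ← integral_const_mul]
  · congr 1
    refine setIntegral_congr_fun isClosed_sphere.measurableSet fun x hx => ?_
    rw [mem_sphere_zero_iff_norm] at hx
    simp [hx]
  · refine Set.disjoint_left.2 fun x hx hx' => ?_
    rw [mem_sphere_zero_iff_norm] at hx'
    rw [Set.mem_ofPred_eq, hx', zpow_le_zpow_iff_right₀ hp1] at hx
    lia

/-- The integral of `|x|⁻² ψ(-x)` vanishes on sets far from the origin that are stable under a suitable translation. -/
lemma Padic.setIntegral_inv_norm_sq_mul_unramified_eq_zero
    (hadd : ∀ x y : ℚ_[p], ψ (x + y) = ψ x * ψ y) {t : ℚ_[p]} (ht : ‖t‖ ≤ p) (hψt : ψ t ≠ 1)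
    {s : Set ℚ_[p]} (hs : MeasurableSet s) (hst : ∀ x, x + -t ∈ s ↔ x ∈ s)
    (hlarge : ∀ x ∈ s, (p : ℝ) < ‖x‖) :
    ∫ x in s, ((‖x‖⁻¹ ^ 2 : ℝ) : ℂ) * ψ (-x) ∂μ = 0 := by
  refine setIntegral_eq_zero_of_add_right_eq_mul hs (t := -t) hψt hst fun x hx => ?_
  rw [Padic.norm_add_eq_of_lt (by rw [norm_neg]; exact ht.trans_lt (hlarge x hx)), neg_add,
    neg_neg, hadd]
  ring

lemma Padic.setIntegral_exterior_unramified (hμ : μ {x : ℚ_[p] | ‖x‖ ≤ 1} = 1)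
    (hadd : ∀ x y : ℚ_[p], ψ (x + y) = ψ x * ψ y) (hcont : Continuous ψ)
    (htriv : ∀ x : ℚ_[p], ‖x‖ ≤ 1 → ψ x = 1) {t : ℚ_[p]} (ht : ‖t‖ ≤ p) (hψt : ψ t ≠ 1)
    (j : ℕ) :
    ∫ x in {x : ℚ_[p] | (p : ℝ) ^ (1 - j : ℤ) ≤ ‖x‖}, ((‖x‖⁻¹ ^ 2 : ℝ) : ℂ) * ψ (-x) ∂μ =
      ((p : ℂ) ^ (1 - j : ℤ))⁻¹ - (p : ℂ)⁻¹ - (p : ℂ)⁻¹ ^ 2 := by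
  have hp1 : (1 : ℝ) < p := by exact_mod_cast hp.out.one_lt
  have hpC : (p : ℂ) ≠ 0 := by exact_mod_cast hp.out.ne_zero
  induction j with
  | zero =>
    have hlt : (p : ℝ) < (p : ℝ) ^ (1 + 1 : ℤ) := by
      simpa using zpow_lt_zpow_right₀ hp1 (show (1 : ℤ) < 1 + 1 by norm_num)
    rw [Nat.cast_zero, sub_zero, Padic.setIntegral_exterior_eq_add hμ hadd hcont htriv,
      Padic.setIntegral_sphere_unramified_one hμ hadd hcont htriv ht hψt,
      Padic.setIntegral_inv_norm_sq_mul_unramified_eq_zero hadd ht hψt]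
    · simp
    · exact measurableSet_le measurable_const measurable_norm
    · exact fun x => Padic.zpow_le_norm_add_iff (by rw [norm_neg]; exact ht.trans_lt hlt)
    · exact fun x hx => hlt.trans_le hx
  | succ j ih =>
    rw [Padic.setIntegral_exterior_eq_add hμ hadd hcont htriv,
      Padic.setIntegral_sphere_unramified_of_nonpos hμ htriv (by push_cast; lia),
      show (1 - (j + 1 : ℕ) : ℤ) + 1 = 1 - j by push_cast; lia, ih,
      show (1 - (j + 1 : ℕ) : ℤ) = -j by push_cast; lia, zpow_sub₀ hpC, zpow_sub₀ hpC, zpow_neg]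
    simp only [zpow_natCast, zpow_one]
    field_simp
    ring

lemma Padic.setIntegral_closedBall_neg_unramified (hμ : μ {x : ℚ_[p] | ‖x‖ ≤ 1} = 1)
    (hadd : ∀ x y : ℚ_[p], ψ (x + y) = ψ x * ψ y)
    (htriv : ∀ x : ℚ_[p], ‖x‖ ≤ 1 → ψ x = 1) {a : ℚ_[p]} {k : ℤ} (hk : k ≤ 0)
    (ha : (p : ℝ) ^ k < ‖a‖) :
    ∫ x in closedBall (-a) ((p : ℝ) ^ k), ((‖x‖⁻¹ ^ 2 : ℝ) : ℂ) * ψ (-x) ∂μ =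
      (p : ℂ) ^ k * (((‖a‖⁻¹ ^ 2 : ℝ) : ℂ) * ψ a) := by
  have hp1 : (1 : ℝ) ≤ p := by exact_mod_cast hp.out.one_le
  rw [setIntegral_congr_fun (g := fun _ => ((‖a‖⁻¹ ^ 2 : ℝ) : ℂ) * ψ a) measurableSet_closedBall,
    setIntegral_const, Padic.measureReal_closedBall_zpow μ hμ]
  · simp
  · intro x hx
    rw [mem_closedBall, dist_eq_norm, sub_neg_eq_add] at hx
    have h1 : ‖x‖ = ‖a‖ := by
      have := Padic.norm_add_eq_of_lt (x := -a) (y := x + a) (by rw [norm_neg]; linarith)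
      rwa [add_comm x, neg_add_cancel_left, norm_neg] at this
    have h2 : ψ (-x) = ψ a := by
      rw [show -x = a + -(x + a) by ring, hadd, htriv (-(x + a)), mul_one]
      rw [norm_neg]
      exact hx.trans (zpow_le_one_of_nonpos₀ hp1 hk)
    simp only [h1, h2]

end UnramifiedCharacter

lemma Padic.setOf_valuation_le_eq {p : ℕ} [hp : Fact p.Prime] (n : ℤ) :
    {x : ℚ_[p] | x ≠ 0 ∧ x.valuation ≤ n} = {x : ℚ_[p] | (p : ℝ) ^ (-n) ≤ ‖x‖} := by
  have hp1 : (1 : ℝ) < p := by exact_mod_cast hp.out.one_lt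
  ext x
  by_cases hx : x = 0
  · have : (0 : ℝ) < (p : ℝ) ^ (-n) := zpow_pos (by linarith) _
    simp [hx, -zpow_neg, this]
  · simp [hx, Padic.norm_eq_zpow_neg_valuation hx, -zpow_neg, zpow_le_zpow_iff_right₀ hp1]

lemma Padic.image_neg_mul_one_add_eq {p : ℕ} [hp : Fact p.Prime] {a : ℚ_[p]} (ha : a ≠ 0) :
    (fun z : ℚ_[p] => -a * (1 + z)) '' {z : ℚ_[p] | ‖z‖ ≤ (p : ℝ)⁻¹} =
      closedBall (-a) ((p : ℝ) ^ (-a.valuation - 1)) := by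
  have hp0 : (0 : ℝ) < p := by exact_mod_cast hp.out.pos
  have hna : 0 < ‖a‖ := norm_pos_iff.2 ha
  rw [zpow_sub_one₀ hp0.ne', ← Padic.norm_eq_zpow_neg_valuation ha]
  ext x
  simp only [Set.mem_image, Set.mem_ofPred_eq, mem_closedBall, dist_eq_norm, sub_neg_eq_add]
  constructor
  · rintro ⟨z, hz, rfl⟩
    rw [show -a * (1 + z) + a = -(a * z) by ring, norm_neg, norm_mul]
    gcongr
  · intro h
    refine ⟨-((x + a) / a), ?_, by field_simp; ring⟩
    rw [norm_neg, norm_div, div_le_iff₀ hna, mul_comm]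
    exact h

/-- For `a ∈ ℚ_pˣ`, let
`S_a = {x ∈ ℚ_pˣ : v(x) ≤ v(a)} \ (−a·U₁)`, where
`−a·U₁ = {−a(1+z) : z ∈ pℤ_p}`.  Then `x ↦ |x|^{−2} ψ(−x)` is integrable on
`S_a`, and `∫_{S_a} |x|^{−2} ψ(−x) dx = |a|^{−1}(1 − ψ(a) q^{−1}) −
q^{−1}(1 + q^{−1})` when `v(a) ≥ −1`, and `= 0` when `v(a) ≤ −2`. -/
theorem integral_inv_norm_sq_addChar_off_coset
    {p : ℕ} [Fact p.Prime] [MeasurableSpace ℚ_[p]] [BorelSpace ℚ_[p]]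
    (μ : Measure ℚ_[p]) [μ.IsAddHaarMeasure]
    (hμ : μ {x : ℚ_[p] | ‖x‖ ≤ 1} = 1)
    -- ψ : an unramified continuous additive character
    (ψ : ℚ_[p] → ℂ)
    (hψadd : ∀ x y : ℚ_[p], ψ (x + y) = ψ x * ψ y)
    (hψcont : Continuous ψ)
    (hψtriv : ∀ x : ℚ_[p], ‖x‖ ≤ 1 → ψ x = 1)
    (hψntriv : ∃ x : ℚ_[p], ‖x‖ ≤ p ∧ ψ x ≠ 1)
    (a : ℚ_[p]) (ha : a ≠ 0) :
    IntegrableOn (fun x : ℚ_[p] => ((‖x‖⁻¹ ^ 2 : ℝ) : ℂ) * ψ (-x))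
      ({x : ℚ_[p] | x ≠ 0 ∧ x.valuation ≤ a.valuation} \
        (fun z : ℚ_[p] => -a * (1 + z)) '' {z : ℚ_[p] | ‖z‖ ≤ (p : ℝ)⁻¹}) μ ∧
    (-1 ≤ a.valuation →
      ∫ x in {x : ℚ_[p] | x ≠ 0 ∧ x.valuation ≤ a.valuation} \
          (fun z : ℚ_[p] => -a * (1 + z)) '' {z : ℚ_[p] | ‖z‖ ≤ (p : ℝ)⁻¹},
          ((‖x‖⁻¹ ^ 2 : ℝ) : ℂ) * ψ (-x) ∂μ =
        ((‖a‖⁻¹ : ℝ) : ℂ) * (1 - ψ a * (p : ℂ)⁻¹) - (p : ℂ)⁻¹ * (1 + (p : ℂ)⁻¹)) ∧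
    (a.valuation ≤ -2 →
      ∫ x in {x : ℚ_[p] | x ≠ 0 ∧ x.valuation ≤ a.valuation} \
          (fun z : ℚ_[p] => -a * (1 + z)) '' {z : ℚ_[p] | ‖z‖ ≤ (p : ℝ)⁻¹},
          ((‖x‖⁻¹ ^ 2 : ℝ) : ℂ) * ψ (-x) ∂μ = 0) := by
  obtain ⟨t, ht, hψt⟩ := hψntriv
  have hp1 : (1 : ℝ) < p := by exact_mod_cast (Fact.out : p.Prime).one_lt
  have hpC : (p : ℂ) ≠ 0 := by exact_mod_cast (Fact.out : p.Prime).ne_zero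
  have hna := Padic.norm_eq_zpow_neg_valuation ha
  have hint := Padic.integrableOn_inv_norm_sq_mul_unramified hμ hψadd hψcont hψtriv (-a.valuation)
  have hlt : (p : ℝ) ^ (-a.valuation - 1) < ‖a‖ := by
    rw [hna]
    exact zpow_lt_zpow_right₀ hp1 (by lia)
  rw [Padic.setOf_valuation_le_eq, Padic.image_neg_mul_one_add_eq ha]
  refine ⟨hint.mono_set Set.sdiff_subset, fun hv => ?_, fun hv => ?_⟩
  · rw [setIntegral_sdiff measurableSet_closedBall hint,
      Padic.setIntegral_closedBall_neg_unramified hμ hψadd hψtriv (by lia) hlt]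
    · obtain ⟨j, hj⟩ : ∃ j : ℕ, -a.valuation = 1 - j := ⟨(a.valuation + 1).toNat, by lia⟩
      rw [hna, hj, Padic.setIntegral_exterior_unramified hμ hψadd hψcont hψtriv ht hψt,
        zpow_sub_one₀ hpC]
      push_cast
      have : (p : ℂ) ^ (1 - j : ℤ) ≠ 0 := zpow_ne_zero _ hpC
      field_simp
      ring
    · intro x hx
      rw [mem_closedBall, dist_eq_norm, sub_neg_eq_add] at hx
      rw [Set.mem_ofPred_eq, ← hna, ← norm_neg a, ← add_neg_cancel_right x a, add_comm]
      exact (Padic.norm_add_eq_of_lt (by rw [norm_neg]; exact hx.trans_lt hlt)).ge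
  · have hp_le : (p : ℝ) ≤ (p : ℝ) ^ (-a.valuation - 1) := by
      simpa using zpow_le_zpow_right₀ hp1.le (show (1 : ℤ) ≤ -a.valuation - 1 by lia)
    rw [hna] at hlt
    refine Padic.setIntegral_inv_norm_sq_mul_unramified_eq_zero hψadd ht hψt
      ((measurableSet_le measurable_const measurable_norm).diff measurableSet_closedBall)
      (fun x => and_congr ?_ (not_congr ?_)) (fun x hx => (hp_le.trans_lt hlt).trans_le hx.1)
    · exact Padic.zpow_le_norm_add_iff (by rw [norm_neg]; linarith)
    · rw [mem_closedBall, mem_closedBall, dist_eq_norm, dist_eq_norm, add_sub_right_comm]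
      exact Padic.norm_add_le_iff_of_le (by rw [norm_neg]; linarith)
end
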